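/- arXiv:0910.1476 — 2 statements merged into one kernel-verified Lean document; each statement's English description precedes it below -/
import Mathlib

section
/- Let C be a connected component of the real variety S_ℝ containing a regular point of S. Then there exists a nonempty subset U_C of ℝⁿ \ S_ℝ, open with respect to the Euclidean topology, with the following property: for every point u ∈ U_C and every point x ∈ S_ℝ that minimizes the Euclidean distance to u among all points of S_ℝ, the point x is a regular point of S belonging to C. -/
open MvPolynomial

noncomputable section

/-- The Zariski closure of a subset of the affine space `σ → ℂ`. -/
def zcl {σ : Type} (T : Set (σ → ℂ)) : Set (σ → ℂ) :=
  MvPolynomial.zeroLocus ℂ (MvPolynomial.vanishingIdeal ℂ T)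

/-- Zariski open subsets of the affine space `σ → ℂ`. -/
def ZOpen {σ : Type} (U : Set (σ → ℂ)) : Prop :=
  ∃ I : Ideal (MvPolynomial σ ℂ), U = {x | ∃ f ∈ I, MvPolynomial.eval x f ≠ 0}

/-- Zariski open subsets of the space of `m × n` complex matrices. -/
def ZOpenMat {m n : ℕ} (U : Set (Matrix (Fin m) (Fin n) ℂ)) : Prop :=
  ∃ I : Ideal (MvPolynomial (Fin m × Fin n) ℂ),
    U = {a | ∃ f ∈ I, MvPolynomial.eval (fun q => a q.1 q.2) f ≠ 0}

/-- `T` is of pure dimension `d`: every irreducible component of (the Zariski closure of) `T`,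
i.e. every minimal prime over its vanishing ideal, has coordinate ring of Krull dimension `d`. -/
def IsPureDim {σ : Type} (T : Set (σ → ℂ)) (d : ℕ) : Prop :=
  ∀ P ∈ (MvPolynomial.vanishingIdeal ℂ T).minimalPrimes,
    ringKrullDim (MvPolynomial σ ℂ ⧸ P) = (d : WithBot (WithTop ℕ))

/-- The Zariski tangent space at a point `x` of (the Zariski closure of) a subset `T`
of affine space: the common kernel of the differentials at `x` of all polynomials
vanishing on `T`. -/
def tangentAt {σ : Type} [Fintype σ] [DecidableEq σ] (T : Set (σ → ℂ)) (x : σ → ℂ) :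
    Submodule ℂ (σ → ℂ) :=
  ⨅ (f : MvPolynomial σ ℂ) (_ : f ∈ MvPolynomial.vanishingIdeal ℂ T),
    LinearMap.ker
      (∑ l, MvPolynomial.eval x (MvPolynomial.pderiv l f) •
        (LinearMap.proj l : (σ → ℂ) →ₗ[ℂ] ℂ))

/-- `rs` is a regular sequence in the commutative ring `R`. -/
def IsRegSeq {R : Type*} [CommRing R] (rs : List R) : Prop :=
  Ideal.span {x | x ∈ rs} ≠ ⊤ ∧
  ∀ j, j < rs.length → ∀ b : R,
    rs.getD j 0 * b ∈ Ideal.span {x | x ∈ rs.take j} →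
    b ∈ Ideal.span {x | x ∈ rs.take j}

/-- The common zero set in `ℂⁿ` of polynomials `F₁, …, F_p ∈ ℚ[X₁, …, Xₙ]`. -/
def zeroSetC {n p : ℕ} (F : Fin p → MvPolynomial (Fin n) ℚ) : Set (Fin n → ℂ) :=
  {x | ∀ k, MvPolynomial.aeval x (F k) = 0}

/-- The Jacobian matrix `[∂F_k/∂X_l]` evaluated at `x ∈ ℂⁿ`. -/
def jacC {n p : ℕ} (F : Fin p → MvPolynomial (Fin n) ℚ) (x : Fin n → ℂ) :
    Matrix (Fin p) (Fin n) ℂ :=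
  Matrix.of fun k l => MvPolynomial.aeval x (MvPolynomial.pderiv l (F k))

/-- The set of regular points of `S = {F₁ = 0, …, F_p = 0}`: points of `S` where the
Jacobian has maximal rank `p`. -/
def SregC {n p : ℕ} (F : Fin p → MvPolynomial (Fin n) ℚ) : Set (Fin n → ℂ) :=
  {x | x ∈ zeroSetC F ∧ (jacC F x).rank = p}

/-- The classic polar variety: the Zariski closure of the locus of regular points of `S`
where the matrix obtained by appending the rows of `a` to the Jacobian has rank at
most `r` (i.e. where all `(r+1)`-minors vanish). -/
def Wclassic {n p m : ℕ} (F : Fin p → MvPolynomial (Fin n) ℚ)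
    (a : Matrix (Fin m) (Fin n) ℂ) (r : ℕ) : Set (Fin n → ℂ) :=
  zcl {x | x ∈ SregC F ∧ (Matrix.fromRows (jacC F x) a).rank ≤ r}

/-- The dual polar variety: as `Wclassic`, with appended rows `(a_{k,1} - X₁, …, a_{k,n} - Xₙ)`. -/
def Wdual {n p m : ℕ} (F : Fin p → MvPolynomial (Fin n) ℚ)
    (a : Matrix (Fin m) (Fin n) ℂ) (r : ℕ) : Set (Fin n → ℂ) :=
  zcl {x | x ∈ SregC F ∧
    (Matrix.fromRows (jacC F x) (Matrix.of fun k l => a k l - x l)).rank ≤ r}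

/-- `F₁, …, F_p` generate the full vanishing ideal of their zero set (over `ℂ`);
this encodes that `(F₁, …, F_p)` is reduced (radical) and the ideal of definition of `S`. -/
def idealOfDef {n p : ℕ} (F : Fin p → MvPolynomial (Fin n) ℚ) : Prop :=
  MvPolynomial.vanishingIdeal ℂ (zeroSetC F) =
    Ideal.span (Set.range fun k => MvPolynomial.map (algebraMap ℚ ℂ) (F k))

/-- The submatrix of the first `m` rows of a matrix. -/
def firstRows {N n' m : ℕ} (a : Matrix (Fin N) (Fin n') ℂ) (h : m ≤ N) :
    Matrix (Fin m) (Fin n') ℂ :=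
  Matrix.of fun k l => a (Fin.castLE h k) l

/-- The matrix obtained by deleting row `h`. -/
def rowErase {m n' : ℕ} (a : Matrix (Fin (m + 1)) (Fin n') ℂ) (h : Fin (m + 1)) :
    Matrix (Fin m) (Fin n') ℂ :=
  Matrix.of fun k l => a (h.succAbove k) l

/-- The real trace `S_ℝ := S ∩ ℝⁿ`, as a subset of Euclidean space. -/
def SR {n p : ℕ} (F : Fin p → MvPolynomial (Fin n) ℚ) : Set (EuclideanSpace ℝ (Fin n)) :=
  {x | (fun j => (x j : ℂ)) ∈ zeroSetC F}

/-- `C` is a connected component of `T`. -/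
def IsConnCompOf {α : Type*} [TopologicalSpace α] (C T : Set α) : Prop :=
  C.Nonempty ∧ C ⊆ T ∧ IsPreconnected C ∧
    ∀ D, C ⊆ D → D ⊆ T → IsPreconnected D → D = C

end

theorem hasStrictFDerivAt_aeval {σ : Type*} [Fintype σ] (P : MvPolynomial σ ℚ)
    (x : EuclideanSpace ℝ σ) :
    HasStrictFDerivAt (fun y : EuclideanSpace ℝ σ => aeval (fun j => y j) P)
      (∑ l, (aeval (fun j => x j) (pderiv l P) : ℝ) •
        (EuclideanSpace.proj l : EuclideanSpace ℝ σ →L[ℝ] ℝ)) x := by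
  classical
  induction P using MvPolynomial.induction_on with
  | C a => simpa using hasStrictFDerivAt_const (algebraMap ℚ ℝ a) x
  | add p q hp hq =>
    refine (hp.add hq).congr_fderiv ?_ |>.congr_of_eventuallyEq (.of_forall fun y => by simp)
    simp [add_smul, Finset.sum_add_distrib]
  | mul_X p i hp =>
    have h := hp.mul (EuclideanSpace.proj i : EuclideanSpace ℝ σ →L[ℝ] ℝ).hasStrictFDerivAt
    refine (h.congr_fderiv ?_).congr_of_eventuallyEq (.of_forall fun y => by simp)
    ext v
    simp [pderiv_X, Pi.single_apply, add_mul, Finset.sum_add_distrib, Finset.mul_sum, ite_mul,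
      apply_ite]
    simp [mul_comm, mul_left_comm]

theorem Matrix.rank_eq_card_iff_linearIndependent_row {m n K : Type*} [Field K] [Fintype m]
    [Fintype n] (A : Matrix m n K) : A.rank = Fintype.card m ↔ LinearIndependent K A.row := by
  rw [A.rank_eq_finrank_span_row, linearIndependent_iff_card_eq_finrank_span, eq_comm]
  rfl

theorem HasStrictFDerivAt.exists_isPreconnected_levelSet {E G : Type*} [NormedAddCommGroup E]
    [NormedSpace ℝ E] [CompleteSpace E] [NormedAddCommGroup G] [NormedSpace ℝ G]
    [FiniteDimensional ℝ G] {f : E → G} {f' : E →L[ℝ] G} {a : E}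
    (hf : HasStrictFDerivAt f f' a) (hf' : f'.range = ⊤) :
    ∃ D ⊆ f ⁻¹' {f a}, a ∈ D ∧ IsPreconnected D ∧ ∀ᶠ y in nhds a, f y = f a → y ∈ D := by
  have : CompleteSpace G := FiniteDimensional.complete ℝ G
  set φ := hf.implicitToOpenPartialHomeomorph f f' hf'
  have hfst : ∀ y, (φ y).1 = f y := hf.implicitToOpenPartialHomeomorph_fst hf'
  have hself : φ a = (f a, 0) := hf.implicitToOpenPartialHomeomorph_self hf'
  have has : a ∈ φ.source := hf.mem_implicitToOpenPartialHomeomorph_source hf'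
  have hat : (f a, (0 : f'.ker)) ∈ φ.target := hf.mem_implicitToOpenPartialHomeomorph_target hf'
  obtain ⟨r, hr, hball⟩ := Metric.isOpen_iff.1 φ.open_target _ hat
  have hsub : ({f a} ×ˢ Metric.ball (0 : f'.ker) r) ⊆ φ.target := by
    rintro ⟨u, v⟩ ⟨rfl, hv⟩
    exact hball (by simpa [Prod.dist_eq, hr] using hv)
  have hmem : ∀ y ∈ φ.source, (φ y).2 ∈ Metric.ball (0 : f'.ker) r → f y = f a →
      y ∈ φ.symm '' ({f a} ×ˢ Metric.ball (0 : f'.ker) r) := fun y hy hr hya =>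
    ⟨φ y, ⟨(hfst y).trans hya, hr⟩, φ.left_inv hy⟩
  refine ⟨φ.symm '' ({f a} ×ˢ Metric.ball (0 : f'.ker) r), ?_, ?_, ?_, ?_⟩
  · rintro _ ⟨z, hz, rfl⟩
    have := hfst (φ.symm z)
    rw [φ.right_inv (hsub hz)] at this
    exact this.symm.trans hz.1
  · exact hmem a has (by rw [hself]; exact Metric.mem_ball_self hr) rfl
  · exact (isPreconnected_singleton.prod (convex_ball _ _).isPreconnected).image _
      (φ.continuousOn_symm.mono hsub)
  · have h2 : ContinuousAt (fun y => (φ y).2) a := (φ.continuousAt has).snd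
    have h0 : (φ a).2 ∈ Metric.ball (0 : f'.ker) r := by
      rw [hself]
      exact Metric.mem_ball_self hr
    filter_upwards [φ.open_source.mem_nhds has, h2 (Metric.isOpen_ball.mem_nhds h0)] with y hy hyr
    exact hmem y hy hyr

/-- The Jacobian matrix `[∂F_k/∂X_l]` evaluated at a real point. -/
noncomputable def jacR {n p : ℕ} (F : Fin p → MvPolynomial (Fin n) ℚ) (x : EuclideanSpace ℝ (Fin n)) :
    Matrix (Fin p) (Fin n) ℝ :=
  Matrix.of fun k l => aeval (fun j => x j) (pderiv l (F k))

theorem aeval_ofReal {σ : Type*} (P : MvPolynomial σ ℚ) (x : σ → ℝ) :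
    aeval (fun j => (x j : ℂ)) P = ((aeval x P : ℝ) : ℂ) :=
  aeval_algebraMap_apply ℂ x P

theorem mem_SR_iff {n p : ℕ} {F : Fin p → MvPolynomial (Fin n) ℚ}
    {x : EuclideanSpace ℝ (Fin n)} :
    x ∈ SR F ↔ ∀ k, aeval (fun j => x j) (F k) = (0 : ℝ) := by
  simp [SR, zeroSetC, aeval_ofReal]

theorem rank_jacC_eq_iff {n p : ℕ} {F : Fin p → MvPolynomial (Fin n) ℚ} {x : Fin n → ℂ} :
    (jacC F x).rank = p ↔ LinearIndependent ℂ (jacC F x).row := by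
  simpa using (jacC F x).rank_eq_card_iff_linearIndependent_row

theorem linearIndependent_row_jacR {n p : ℕ} {F : Fin p → MvPolynomial (Fin n) ℚ}
    {x : EuclideanSpace ℝ (Fin n)} (h : (jacC F fun j => (x j : ℂ)).rank = p) :
    LinearIndependent ℝ (jacR F x).row := by
  have h' := (rank_jacC_eq_iff.1 h).restrict_scalars' ℝ
  refine LinearIndependent.of_comp (Complex.ofRealCLM.toLinearMap.compLeft (Fin n)) ?_
  convert h' using 1
  ext k l
  exact (aeval_ofReal _ _).symm

theorem surjective_mulVec_jacR {n p : ℕ} {F : Fin p → MvPolynomial (Fin n) ℚ}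
    {x : EuclideanSpace ℝ (Fin n)} (h : (jacC F fun j => (x j : ℂ)).rank = p) :
    Function.Surjective (jacR F x).mulVec := by
  have hr := (jacR F x).rank_eq_card_iff_linearIndependent_row.2 (linearIndependent_row_jacR h)
  have : (jacR F x).mulVecLin.range = ⊤ :=
    Submodule.eq_top_of_finrank_eq (by simpa [Matrix.rank] using hr)
  exact LinearMap.range_eq_top.1 this

theorem eventually_rank_jacC {n p : ℕ} {F : Fin p → MvPolynomial (Fin n) ℚ}
    {x : EuclideanSpace ℝ (Fin n)} (h : (jacC F fun j => (x j : ℂ)).rank = p) :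
    ∀ᶠ y in nhds x, (jacC F fun j => (y j : ℂ)).rank = p := by
  simp only [rank_jacC_eq_iff] at h ⊢
  have hcont : Continuous fun y : EuclideanSpace ℝ (Fin n) =>
      (jacC F fun j => (y j : ℂ)).row := by
    refine continuous_pi fun k => continuous_pi fun l => ?_
    simp only [Matrix.row, jacC, Matrix.of_apply, aeval_ofReal]
    exact Complex.continuous_ofReal.comp <| continuous_iff_continuousAt.2 fun y =>
      (hasStrictFDerivAt_aeval (pderiv l (F k)) y).continuousAt
  exact hcont.continuousAt (isOpen_setOfPred_linearIndependent.mem_nhds h)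

theorem isClosed_SR {n p : ℕ} (F : Fin p → MvPolynomial (Fin n) ℚ) : IsClosed (SR F) := by
  have : SR F = ⋂ k, {x | aeval (fun j => x j) (F k) = (0 : ℝ)} := by
    ext x
    simp [mem_SR_iff]
  rw [this]
  exact isClosed_iInter fun k => isClosed_singleton.preimage <|
    continuous_iff_continuousAt.2 fun y => (hasStrictFDerivAt_aeval (F k) y).continuousAt

/-- Near a regular point, `S_ℝ` is locally connected. -/
theorem exists_isPreconnected_subset_SR {n p : ℕ} {F : Fin p → MvPolynomial (Fin n) ℚ}
    {x : EuclideanSpace ℝ (Fin n)} (hx : x ∈ SR F)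
    (h : (jacC F fun j => (x j : ℂ)).rank = p) :
    ∃ D ⊆ SR F, x ∈ D ∧ IsPreconnected D ∧ ∀ᶠ y in nhds x, y ∈ SR F → y ∈ D := by
  let f : EuclideanSpace ℝ (Fin n) → Fin p → ℝ := fun y k => aeval (fun j => y j) (F k)
  have hf : HasStrictFDerivAt f _ x :=
    hasStrictFDerivAt_pi.2 fun k => hasStrictFDerivAt_aeval (F k) x
  have hzero : ∀ y, y ∈ SR F ↔ f y = f x := fun y => by
    have hfx : f x = 0 := funext (mem_SR_iff.1 hx)
    rw [hfx, mem_SR_iff, funext_iff]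
    rfl
  obtain ⟨D, hD, hxD, hDc, hev⟩ := hf.exists_isPreconnected_levelSet (by
    refine LinearMap.range_eq_top.2 fun w => ?_
    obtain ⟨v, hv⟩ := surjective_mulVec_jacR h w
    refine ⟨WithLp.toLp 2 v, ?_⟩
    rw [← hv]
    ext k
    simp [jacR, Matrix.mulVec, dotProduct])
  exact ⟨D, fun y hy => (hzero y).2 (hD hy), hxD, hDc, hev.mono fun y hy hyS =>
    hy ((hzero y).1 hyS)⟩

theorem SR_notMem_nhds {n p : ℕ} (hp : 1 ≤ p) {F : Fin p → MvPolynomial (Fin n) ℚ}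
    {x : EuclideanSpace ℝ (Fin n)} (h : (jacC F fun j => (x j : ℂ)).rank = p) :
    SR F ∉ nhds x := by
  intro hS
  let k : Fin p := ⟨0, hp⟩
  have h0 : HasFDerivAt (fun y : EuclideanSpace ℝ (Fin n) => (aeval (fun j => y j) (F k) : ℝ))
      (0 : EuclideanSpace ℝ (Fin n) →L[ℝ] ℝ) x :=
    (hasFDerivAt_const (0 : ℝ) x).congr_of_eventuallyEq <|
      Filter.mem_of_superset hS fun y hy => mem_SR_iff.1 hy k
  have heq := (hasStrictFDerivAt_aeval (F k) x).hasFDerivAt.unique h0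
  refine (linearIndependent_row_jacR h).ne_zero k (funext fun l => ?_)
  simpa [jacR, Matrix.row, Pi.single_apply] using
    congrArg (fun L => L (EuclideanSpace.single l (1 : ℝ))) heq

/-- Lemma 1 of the paper. Let `S = {F₁ = 0, …, F_p = 0} ⊆ ℂⁿ` be defined
by a reduced regular sequence, nonempty and equidimensional of dimension `n - p`.
Let `C` be a connected component of `S_ℝ` containing a regular point of `S`. Then there is
a nonempty Euclidean-open subset `U ⊆ ℝⁿ \ S_ℝ` such that for every `u ∈ U`, every point
`x ∈ S_ℝ` minimizing the Euclidean distance to `u` among points of `S_ℝ` is a regular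
point of `S` belonging to `C`. -/
theorem statement0 {n p : ℕ} (hp1 : 1 ≤ p) (hpn : p ≤ n)
    (F : Fin p → MvPolynomial (Fin n) ℚ)
    (hreg : IsRegSeq (List.ofFn F))
    (hrad : idealOfDef F)
    (hSne : (zeroSetC F).Nonempty)
    (hSdim : IsPureDim (zeroSetC F) (n - p))
    (C : Set (EuclideanSpace ℝ (Fin n)))
    (hC : IsConnCompOf C (SR F))
    (hCreg : ∃ x ∈ C, (fun j => (x j : ℂ)) ∈ SregC F) :
    ∃ U : Set (EuclideanSpace ℝ (Fin n)),
      U.Nonempty ∧ IsOpen U ∧ U ⊆ (SR F)ᶜ ∧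
      ∀ u ∈ U, ∀ x ∈ SR F, (∀ y ∈ SR F, dist u x ≤ dist u y) →
        x ∈ C ∧ (fun j => (x j : ℂ)) ∈ SregC F := by
  obtain ⟨x₀, hx₀C, hx₀, hrank⟩ := hCreg
  obtain ⟨-, hCS, hCc, hCmax⟩ := hC
  obtain ⟨D, hDS, hxD, hDc, hDev⟩ := exists_isPreconnected_subset_SR hx₀ hrank
  have hDC : D ⊆ C := by
    rw [← hCmax (C ∪ D) Set.subset_union_left (Set.union_subset hCS hDS)
      (hCc.union x₀ hx₀C hxD hDc)]
    exact Set.subset_union_right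
  obtain ⟨r, hr, hball⟩ := Metric.eventually_nhds_iff.1 (hDev.and (eventually_rank_jacC hrank))
  refine ⟨Metric.ball x₀ (r / 2) \ SR F, ?_, Metric.isOpen_ball.sdiff (isClosed_SR F),
    fun u hu => hu.2, fun u hu x hx hmin => ?_⟩
  · by_contra hempty
    exact SR_notMem_nhds hp1 hrank (Filter.mem_of_superset
      (Metric.ball_mem_nhds x₀ (half_pos hr))
      (Set.sdiff_eq_empty.1 (Set.not_nonempty_iff_eq_empty.1 hempty)))
  · have hux : dist u x₀ < r / 2 := hu.1
    have hxx₀ : dist x x₀ < r := by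
      linarith [dist_triangle_left x x₀ u, hmin x₀ hx₀]
    obtain ⟨hxD', hxr⟩ := hball hxx₀
    exact ⟨hDC (hxD' hx), hx, hxr⟩
end

section
/- Suppose that the real variety S_ℝ contains a regular point of S and let 1 ≤ i ≤ n−p. Then there exists a nonempty subset O^{(i)} of ℝ^{(n−p−i+1)×n}, open with respect to the Euclidean topology, such that every matrix a ∈ O^{(i)} has maximal rank n−p−i+1 and the dual polar variety W_{\bar K(\bar a)}(S) is generic (empty or of pure codimension i in S) and nonempty. -/
open MvPolynomial

theorem ringKrullDim_eq_of_isIntegral_of_injective {R S : Type*} [CommRing R] [CommRing S]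
    [Algebra R S] [Algebra.IsIntegral R S] (hinj : Function.Injective (algebraMap R S)) :
    ringKrullDim R = ringKrullDim S := by
  apply le_antisymm
  · refine iSup_le fun l => ?_
    obtain ⟨P, -, hP, hPl⟩ := Ideal.exists_ideal_over_prime_of_isIntegral
      (RelSeries.head l).asIdeal (⊥ : Ideal S)
      (by
        rw [← RingHom.ker_eq_comap_bot, (RingHom.injective_iff_ker_eq_bot _).mp hinj]
        exact bot_le)
    have : P.LiesOver (RelSeries.head l).asIdeal := ⟨hPl.symm⟩
    obtain ⟨L, hL, -⟩ := Ideal.exists_ltSeries_of_hasGoingUp l P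
    rw [← hL]
    exact le_iSup (fun L : LTSeries (PrimeSpectrum S) => (L.length : WithBot ℕ∞)) L
  · exact Order.krullDim_le_of_strictMono (PrimeSpectrum.comap (algebraMap R S))
      fun I J h => Ideal.IsIntegral.comap_lt_comap (R := R) h

theorem exists_ringKrullDim_eq_and_trdeg_eq (k D : Type) [Field k] [CommRing D] [IsDomain D]
    [Algebra k D] [Algebra.FiniteType k D] :
    ∃ s : ℕ, ringKrullDim D = s ∧ Algebra.trdeg k D = s := by
  obtain ⟨s, g, hg, hintegral⟩ := exists_integral_inj_algHom_of_fg k D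
  refine ⟨s, ?_, ?_⟩
  · algebraize [g.toRingHom]
    have : Algebra.IsIntegral (MvPolynomial (Fin s) k) D := ⟨hintegral⟩
    rw [← ringKrullDim_eq_of_isIntegral_of_injective (R := MvPolynomial (Fin s) k) (S := D) hg,
      MvPolynomial.ringKrullDim_of_isNoetherianRing]
    simp [ringKrullDim_eq_zero_of_field]
  · algebraize [g.toRingHom]
    have : IsScalarTower k (MvPolynomial (Fin s) k) D :=
      IsScalarTower.of_algebraMap_eq fun x => (g.commutes x).symm
    have : FaithfulSMul (MvPolynomial (Fin s) k) D :=
      (faithfulSMul_iff_algebraMap_injective _ _).mpr hg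
    have : Algebra.IsIntegral (MvPolynomial (Fin s) k) D := ⟨hintegral⟩
    have h0 : Algebra.trdeg (MvPolynomial (Fin s) k) D = 0 := by
      exact trdeg_eq_zero
    rw [← trdeg_add_eq k (MvPolynomial (Fin s) k) (A := D), h0]
    simp

theorem AlgebraicIndependent.natCard_le_ringKrullDim {k R ι : Type} [Field k] [CommRing R]
    [Algebra k R] [Algebra.FiniteType k R] [Finite ι] {f : ι → R}
    (hf : AlgebraicIndependent k f) : (Nat.card ι : WithBot ℕ∞) ≤ ringKrullDim R := by
  obtain ⟨Q, -, hQ, hQle⟩ := Ideal.exists_ideal_comap_le_prime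
    (f := ((aeval f : MvPolynomial ι k →ₐ[k] R) : MvPolynomial ι k →+* R)) ⊥ ⊥
    (by
      rw [← RingHom.ker_eq_comap_bot]
      exact ((RingHom.injective_iff_ker_eq_bot _).mp hf).le)
  have hind : AlgebraicIndependent k (Ideal.Quotient.mkₐ k Q ∘ f) := by
    rw [algebraicIndependent_iff]
    intro p hp
    replace hp : Ideal.Quotient.mkₐ k Q (aeval f p) = 0 := by rw [comp_aeval_apply]; exact hp
    rw [Ideal.Quotient.mkₐ_eq_mk, Ideal.Quotient.eq_zero_iff_mem] at hp
    exact hQle hp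
  obtain ⟨s, h1, h2⟩ := exists_ringKrullDim_eq_and_trdeg_eq k (R ⧸ Q)
  have h3 := hind.cardinalMk_le_trdeg
  rw [h2, ← Nat.cast_card, Nat.cast_le] at h3
  calc (Nat.card ι : WithBot ℕ∞) ≤ s := by exact_mod_cast h3
    _ = ringKrullDim (R ⧸ Q) := h1.symm
    _ ≤ _ := ringKrullDim_quotient_le Q

theorem exists_algebraicIndependent_X {k R : Type} [Field k] [CommRing R] [IsDomain R]
    [Algebra k R] [Algebra.FiniteType k R] {d : ℕ} {ι : Type} (x : ι → R)
    [halg : Algebra.IsAlgebraic (Algebra.adjoin k (Set.range x)) R]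
    (hd : (d : WithBot ℕ∞) ≤ ringKrullDim R) :
    ∃ t : Fin d → ι, AlgebraicIndependent k (x ∘ t) := by
  obtain ⟨s, h1, h2⟩ := exists_ringKrullDim_eq_and_trdeg_eq k R
  obtain ⟨T, hT, hbasis⟩ := exists_isTranscendenceBasis_subset (R := k) (Set.range x)
  have hcard := hbasis.cardinalMk_eq_trdeg
  rw [h2] at hcard
  have hfin : Finite T := by
    rw [← Cardinal.lt_aleph0_iff_finite, hcard]
    exact Cardinal.natCast_lt_aleph0
  have hds : d ≤ Nat.card T := by
    have : Nat.card T = s := by rw [Nat.card, hcard]; simp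
    rw [this]; rw [h1] at hd; exact_mod_cast hd
  let e : Fin d ↪ T := (Fin.castLEEmb hds).trans (Finite.equivFin T).symm.toEmbedding
  choose y hy using fun j => hT (e j).2
  refine ⟨y, ?_⟩
  have : x ∘ y = (fun z : T => (z : R)) ∘ e := funext hy
  rw [this]
  exact hbasis.1.comp e e.injective

theorem height_vanishingIdeal_singleton {σ : Type} [Finite σ] (x y : σ → ℂ) :
    (vanishingIdeal ℂ {x}).height = (vanishingIdeal ℂ {y}).height := by
  let tr : (σ → ℂ) → (MvPolynomial σ ℂ →ₐ[ℂ] MvPolynomial σ ℂ) :=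
    fun v => aeval fun i => X i + C (v i)
  have h1 : ∀ v w : σ → ℂ, v + w = 0 → (tr v).comp (tr w) = AlgHom.id _ _ := by
    intro v w h
    ext i : 1
    have := congrFun h i
    simp only [Pi.add_apply, Pi.zero_apply] at this
    simp [tr, add_assoc, ← C_add, this]
  let e : MvPolynomial σ ℂ ≃ₐ[ℂ] MvPolynomial σ ℂ :=
    AlgEquiv.ofAlgHom (tr (x - y)) (tr (y - x)) (h1 _ _ (by simp)) (h1 _ _ (by simp))
  have : vanishingIdeal ℂ {x} = (vanishingIdeal ℂ {y}).comap e.toRingEquiv := by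
    ext f
    have h : (aeval y : MvPolynomial σ ℂ →ₐ[ℂ] ℂ).comp (tr (x - y)) = aeval x := by
      ext i
      simp [tr]
    rw [Ideal.mem_comap, mem_vanishingIdeal_singleton_iff, mem_vanishingIdeal_singleton_iff, ← h]
    rfl
  rw [this, RingEquiv.height_comap]

theorem natCard_le_height_vanishingIdeal_singleton {σ : Type} [Finite σ] (x : σ → ℂ) :
    (Nat.card σ : ℕ∞) ≤ (vanishingIdeal ℂ {x}).height := by
  have hdim : ringKrullDim (MvPolynomial σ ℂ) = Nat.card σ := by
    rw [MvPolynomial.ringKrullDim_of_isNoetherianRing]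
    simp [ringKrullDim_eq_zero_of_field]
  rw [← Ideal.sup_isMaximal_height_eq_ringKrullDim] at hdim
  have hdim' : (⨆ (I : Ideal (MvPolynomial σ ℂ)) (_ : I.IsMaximal), I.height) = (Nat.card σ : ℕ∞) := by
    exact_mod_cast hdim
  rw [← hdim']
  refine iSup₂_le fun I hI => ?_
  obtain ⟨y, rfl⟩ := isMaximal_iff_eq_vanishingIdeal_singleton.mp hI
  exact (height_vanishingIdeal_singleton y x).le

theorem exists_isPrime_le_card_add_ringKrullDim {σ : Type} [Finite σ] (x : σ → ℂ)
    (s : Set (MvPolynomial σ ℂ)) {r d : ℕ} (hs : s.encard ≤ r) (hx : ∀ f ∈ s, aeval x f = 0)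
    (hd : d + r ≤ Nat.card σ) :
    ∃ Q : Ideal (MvPolynomial σ ℂ), Q.IsPrime ∧ s ⊆ Q ∧ Q ≤ vanishingIdeal ℂ {x} ∧
      (d : WithBot ℕ∞) ≤ ringKrullDim (MvPolynomial σ ℂ ⧸ Q) := by
  set M := vanishingIdeal ℂ {x}
  have hsM : s ⊆ M := fun f hf => (mem_vanishingIdeal_singleton_iff x f).mpr (hx f hf)
  have h1 := (natCard_le_height_vanishingIdeal_singleton x).trans
    (Ideal.height_le_height_add_encard_of_subset s hsM)
  set I := Ideal.span s
  have hIM : I ≤ M := Ideal.span_le.mpr hsM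
  have hprime : (M.map (Ideal.Quotient.mk I)).IsPrime :=
    Ideal.isPrime_map_quotientMk_of_isPrime hIM
  have h2 : (d : ℕ∞) ≤ (M.map (Ideal.Quotient.mk I)).height := by
    have h3 : ((d + r : ℕ) : ℕ∞) ≤ (M.map (Ideal.Quotient.mk I)).height + r :=
      (Nat.cast_le.mpr hd).trans (h1.trans (by gcongr))
    rw [Nat.cast_add] at h3
    exact (ENat.add_le_add_iff_right (ENat.natCast_ne_top r)).mp h3
  let M' : PrimeSpectrum (MvPolynomial σ ℂ ⧸ I) := ⟨_, hprime⟩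
  have h2' : (d : ℕ∞) ≤ Order.height M' := by
    rw [← PrimeSpectrum.height_eq_orderHeight]; exact h2
  obtain ⟨l, hl, hlen⟩ := Order.exists_series_of_le_height M' h2'
  refine ⟨(RelSeries.head l).asIdeal.comap (Ideal.Quotient.mk I), inferInstance, ?_, ?_, ?_⟩
  · intro f hf
    have : Ideal.Quotient.mk I f = 0 := Ideal.Quotient.eq_zero_iff_mem.mpr (Ideal.subset_span hf)
    simp [this]
  · have : RelSeries.head l ≤ M' := hl ▸ LTSeries.head_le_last l
    have := Ideal.comap_mono (f := Ideal.Quotient.mk I) this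
    refine this.trans ?_
    show (M.map (Ideal.Quotient.mk I)).comap (Ideal.Quotient.mk I) ≤ M
    rw [Ideal.comap_map_of_surjective _ Ideal.Quotient.mk_surjective, ← RingHom.ker_eq_comap_bot,
      Ideal.mk_ker]
    exact sup_le le_rfl hIM
  · rw [ringKrullDim_quotient, ← hlen]
    have hmono : StrictMono (PrimeSpectrum.comap (Ideal.Quotient.mk I)) := by
      intro a b hab
      exact lt_of_le_of_ne (Ideal.comap_mono hab.le) fun h => hab.ne
        (PrimeSpectrum.comap_injective_of_surjective _ Ideal.Quotient.mk_surjective h)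
    let L : LTSeries (PrimeSpectrum.zeroLocus (R := MvPolynomial σ ℂ)
        ((RelSeries.head l).asIdeal.comap (Ideal.Quotient.mk I))) :=
      { length := l.length
        toFun := fun j => ⟨PrimeSpectrum.comap (Ideal.Quotient.mk I) (l j),
          Ideal.comap_mono (LTSeries.head_le l j)⟩
        step := fun j => hmono (l.step j) }
    exact le_iSup (fun L : LTSeries (PrimeSpectrum.zeroLocus (R := MvPolynomial σ ℂ)
        ((RelSeries.head l).asIdeal.comap (Ideal.Quotient.mk I))) => (L.length : WithBot ℕ∞)) L

/-- A property of points of `ℂ^α` holds generically if it holds off a proper hypersurface. -/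
def HoldsGenerically {α : Type} (Φ : (α → ℂ) → Prop) : Prop :=
  ∃ g : MvPolynomial α ℂ, g ≠ 0 ∧ ∀ a, aeval a g ≠ 0 → Φ a

theorem HoldsGenerically.and {α : Type} {Φ Ψ : (α → ℂ) → Prop} (h₁ : HoldsGenerically Φ)
    (h₂ : HoldsGenerically Ψ) : HoldsGenerically fun a => Φ a ∧ Ψ a := by
  obtain ⟨g₁, h₁, H₁⟩ := h₁
  obtain ⟨g₂, h₂, H₂⟩ := h₂
  refine ⟨g₁ * g₂, mul_ne_zero h₁ h₂, fun a ha => ?_⟩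
  rw [map_mul] at ha
  exact ⟨H₁ a (left_ne_zero_of_mul ha), H₂ a (right_ne_zero_of_mul ha)⟩

theorem HoldsGenerically.forall {α ι : Type} [Finite ι] {Φ : ι → (α → ℂ) → Prop}
    (h : ∀ j, HoldsGenerically (Φ j)) : HoldsGenerically fun a => ∀ j, Φ j a := by
  have := Fintype.ofFinite ι
  choose g hg H using h
  refine ⟨∏ j, g j, Finset.prod_ne_zero_iff.mpr fun j _ => hg j, fun a ha j => ?_⟩
  rw [map_prod] at ha
  exact H j a (Finset.prod_ne_zero_iff.mp ha j (Finset.mem_univ j))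

theorem HoldsGenerically.mono {α : Type} {Φ Ψ : (α → ℂ) → Prop} (h : HoldsGenerically Φ)
    (hΦ : ∀ a, Φ a → Ψ a) : HoldsGenerically Ψ := by
  obtain ⟨g, h, H⟩ := h
  exact ⟨g, h, fun a ha => hΦ a (H a ha)⟩

theorem HoldsGenerically.exists_real {α : Type} [Finite α] {Φ : (α → ℂ) → Prop}
    (h : HoldsGenerically Φ) :
    ∃ V : Set (α → ℝ), IsOpen V ∧ Dense V ∧ ∀ a ∈ V, Φ fun q => (a q : ℂ) := by
  obtain ⟨g, hg, H⟩ := h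
  have := Fintype.ofFinite α
  have hcont : Continuous fun a : α → ℝ => aeval (fun q => (a q : ℂ)) g := by
    have h1 : Continuous fun b : α → ℂ => eval b g := continuous_eval g
    simp only [MvPolynomial.aeval_eq_eval]
    exact h1.comp (by fun_prop)
  refine ⟨{a | aeval (fun q => (a q : ℂ)) g ≠ 0}, hcont.isOpen_preimage _ isOpen_compl_singleton, ?_,
    fun a ha => H _ ha⟩
  intro a
  rw [Metric.mem_closure_iff]
  intro ε hε
  by_contra! hcon
  apply hg
  refine MvPolynomial.funext_set (fun q => (fun t : ℝ => (t : ℂ)) '' Metric.ball (a q) ε)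
    (fun q => Set.Infinite.image Complex.ofReal_injective.injOn ?_) fun b hb => ?_
  · rw [Real.ball_eq_Ioo]; exact Set.Ioo_infinite (by linarith)
  · choose c hc hcb using fun q => hb q (Set.mem_univ q)
    have : b = fun q => (c q : ℂ) := funext fun q => (hcb q).symm
    rw [map_zero]
    by_contra h0
    have h2 := hcon c (by rw [this] at h0; simpa [MvPolynomial.aeval_eq_eval] using h0)
    rw [dist_comm] at h2
    exact absurd ((dist_pi_lt_iff hε).mpr hc) (not_lt.mpr h2)

theorem holdsGenerically_specialize_ne_zero {α β : Type} {H : MvPolynomial (β ⊕ α) ℂ} (hH : H ≠ 0) :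
    HoldsGenerically fun a : α → ℂ =>
      aeval (Sum.elim X (C ∘ a) : β ⊕ α → MvPolynomial β ℂ) H ≠ 0 := by
  have h1 : sumAlgEquiv ℂ β α H ≠ 0 := by simpa using hH
  obtain ⟨d, hd⟩ := ne_zero_iff.mp h1
  refine ⟨_, hd, fun a ha h0 => ha ?_⟩
  have h2 : (mapAlgHom (aeval a)).comp (sumAlgEquiv ℂ β α : MvPolynomial (β ⊕ α) ℂ →ₐ[ℂ] _) =
      aeval (Sum.elim X (C ∘ a) : β ⊕ α → MvPolynomial β ℂ) := by
    ext q : 1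
    rcases q with q | q <;> simp
  rw [← h2] at h0
  have h3 := congrArg (coeff d) h0
  simpa [coeff_map] using h3

theorem holdsGenerically_exists_relation {α β B : Type} [Finite α] [Finite β] [CommRing B]
    [Algebra ℂ B] [Algebra.FiniteType ℂ B] (y : β → B) (A : α → B)
    (hB : ringKrullDim B < (Nat.card β + Nat.card α : ℕ)) :
    HoldsGenerically fun a : α → ℂ => ∃ H : MvPolynomial β ℂ, H ≠ 0 ∧
      ∀ φ : B →ₐ[ℂ] ℂ, φ ∘ A = a → aeval (φ ∘ y) H = 0 := by
  have h1 : ¬ AlgebraicIndependent ℂ (Sum.elim y A) := fun h => by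
    have := h.natCard_le_ringKrullDim
    rw [Nat.card_sum] at this
    exact absurd this (not_le.mpr hB)
  rw [algebraicIndependent_iff] at h1
  push Not at h1
  obtain ⟨H, hH0, hH⟩ := h1
  refine (holdsGenerically_specialize_ne_zero hH).mono fun a ha => ⟨_, ha, fun φ hφ => ?_⟩
  have h2 : (aeval (φ ∘ y)).comp (aeval (Sum.elim X (C ∘ a) : β ⊕ α → MvPolynomial β ℂ)) =
      φ.comp (aeval (Sum.elim y A)) := by
    ext q
    rcases q with q | q
    · simp
    · simp [← hφ]
  have h3 := DFunLike.congr_fun h2 H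
  rw [AlgHom.comp_apply, AlgHom.comp_apply, hH0, map_zero] at h3
  exact h3

theorem ringKrullDim_quotient_le_of_minimalPrimes {R : Type*} [CommRing R] {I : Ideal R} {d : ℕ}
    (h : ∀ P ∈ I.minimalPrimes, ringKrullDim (R ⧸ P) ≤ d) : ringKrullDim (R ⧸ I) ≤ d := by
  rw [ringKrullDim_quotient]
  refine iSup_le fun l => ?_
  obtain ⟨P, hP, hPle⟩ := Ideal.exists_minimalPrimes_le (J := (RelSeries.head l).1.asIdeal)
    (I := I) (RelSeries.head l).2
  refine le_trans ?_ (h P hP)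
  rw [ringKrullDim_quotient]
  let L : LTSeries (PrimeSpectrum.zeroLocus (R := R) P) :=
    { length := l.length
      toFun := fun j => ⟨(l j).1, hPle.trans (LTSeries.head_le l j)⟩
      step := fun j => l.step j }
  exact le_iSup (fun L : LTSeries (PrimeSpectrum.zeroLocus (R := R) P) =>
    (L.length : WithBot ℕ∞)) L

theorem holdsGenerically_exists_relation_of_nonZeroDivisor {α β B : Type} [Finite α] [Finite β]
    [CommRing B] [Algebra ℂ B] [Algebra.FiniteType ℂ B] (y : β → B) (A : α → B) {z : B}
    (hz : ∀ b, b * z = 0 → b = 0) (hB : ringKrullDim B ≤ (Nat.card β + Nat.card α : ℕ)) :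
    HoldsGenerically fun a : α → ℂ => ∃ H : MvPolynomial β ℂ, H ≠ 0 ∧
      ∀ φ : B →ₐ[ℂ] ℂ, φ z = 0 → φ ∘ A = a → aeval (φ ∘ y) H = 0 := by
  have hz' : z ∈ nonZeroDivisors B := mem_nonZeroDivisors_iff_right.mpr hz
  have hlt : ringKrullDim (B ⧸ Ideal.span {z}) < (Nat.card β + Nat.card α : ℕ) :=
    ENat.WithBot.add_one_le_natCast_iff.mp
      ((ringKrullDim_quotient_succ_le_of_nonZeroDivisor hz').trans hB)
  refine (holdsGenerically_exists_relation (Ideal.Quotient.mkₐ ℂ (Ideal.span {z}) ∘ y)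
    (Ideal.Quotient.mkₐ ℂ (Ideal.span {z}) ∘ A) hlt).mono ?_
  rintro a ⟨H, hH0, hH⟩
  refine ⟨H, hH0, fun φ hφ0 hφ => ?_⟩
  have hker : ∀ b ∈ Ideal.span {z}, φ b = 0 := by
    intro b hb
    obtain ⟨c, rfl⟩ := Ideal.mem_span_singleton'.mp hb
    rw [map_mul, hφ0, mul_zero]
  exact hH (Ideal.Quotient.liftₐ _ φ hker) hφ

section Relations

variable {σ ρ : Type}

/-- Evaluation at a point of `T`, as a map on the coordinate ring of `T`. -/
noncomputable def evalCoord (T : Set (σ → ℂ)) (x : σ → ℂ) (hx : x ∈ T) :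
    (MvPolynomial σ ℂ ⧸ vanishingIdeal ℂ T) →ₐ[ℂ] ℂ :=
  Ideal.Quotient.liftₐ _ (aeval x) fun _ hf => hf x hx

/-- The restriction of polynomials to `T × ℂ^ρ`. -/
noncomputable def restrictCoord (ρ : Type) (T : Set (σ → ℂ)) :
    MvPolynomial (σ ⊕ ρ) ℂ →ₐ[ℂ] MvPolynomial ρ (MvPolynomial σ ℂ ⧸ vanishingIdeal ℂ T) :=
  aeval (Sum.elim (fun j => C (Ideal.Quotient.mk _ (X j))) X)

theorem aevalTower_comp_restrictCoord (T : Set (σ → ℂ)) (x : σ → ℂ) (hx : x ∈ T) (r : ρ → ℂ) :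
    (aevalTower (evalCoord T x hx) r).comp (restrictCoord ρ T) = aeval (Sum.elim x r) := by
  ext q
  rcases q with q | q
  · simp [restrictCoord, evalCoord]
  · simp [restrictCoord]

theorem aevalTower_restrictCoord (T : Set (σ → ℂ)) (x : σ → ℂ) (hx : x ∈ T) (r : ρ → ℂ)
    (f : MvPolynomial (σ ⊕ ρ) ℂ) :
    aevalTower (evalCoord T x hx) r (restrictCoord ρ T f) = aeval (Sum.elim x r) f :=
  DFunLike.congr_fun (aevalTower_comp_restrictCoord T x hx r) f

theorem eq_zero_of_mul_restrictCoord_eq_zero {T : Set (σ → ℂ)} {h : MvPolynomial (σ ⊕ ρ) ℂ}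
    (hh : ∀ x ∈ T, ∃ r, aeval (Sum.elim x r) h ≠ 0)
    (b : MvPolynomial ρ (MvPolynomial σ ℂ ⧸ vanishingIdeal ℂ T))
    (hb : b * restrictCoord ρ T h = 0) : b = 0 := by
  have key : ∀ x (hx : x ∈ T), map (evalCoord T x hx : _ →+* ℂ) b = 0 := by
    intro x hx
    have h1 := congrArg (map (evalCoord T x hx : _ →+* ℂ)) hb
    rw [map_mul, map_zero] at h1
    refine (mul_eq_zero.mp h1).resolve_right fun h2 => ?_
    obtain ⟨r, hr⟩ := hh x hx
    apply hr
    rw [← aevalTower_restrictCoord T x hx, ← map_zero (eval r), ← h2, eval_map]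
    rfl
  ext d
  obtain ⟨f, hf⟩ := Ideal.Quotient.mk_surjective (coeff d b)
  rw [coeff_zero, ← hf, Ideal.Quotient.eq_zero_iff_mem, mem_vanishingIdeal_iff]
  intro x hx
  have h3 := congrArg (coeff d) (key x hx)
  rw [coeff_map, ← hf, coeff_zero] at h3
  exact h3

variable [Finite σ] [Finite ρ]

theorem ringKrullDim_restrictCoord_le {T : Set (σ → ℂ)} {d : ℕ}
    (hT : ringKrullDim (MvPolynomial σ ℂ ⧸ vanishingIdeal ℂ T) ≤ d) :
    ringKrullDim (MvPolynomial ρ (MvPolynomial σ ℂ ⧸ vanishingIdeal ℂ T)) ≤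
      (d + Nat.card ρ : ℕ) := by
  rw [MvPolynomial.ringKrullDim_of_isNoetherianRing, Nat.cast_add]
  gcongr

instance (T : Set (σ → ℂ)) : Algebra.FiniteType ℂ
    (MvPolynomial ρ (MvPolynomial σ ℂ ⧸ vanishingIdeal ℂ T)) :=
  Algebra.FiniteType.trans (S := MvPolynomial σ ℂ ⧸ vanishingIdeal ℂ T) inferInstance inferInstance

theorem holdsGenerically_relation_on {α β : Type} [Finite α] [Finite β] {T : Set (σ → ℂ)} {d : ℕ}
    (hT : ringKrullDim (MvPolynomial σ ℂ ⧸ vanishingIdeal ℂ T) ≤ d)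
    (hd : d + Nat.card ρ < Nat.card β + Nat.card α)
    (y : β → MvPolynomial (σ ⊕ ρ) ℂ) (A : α → MvPolynomial (σ ⊕ ρ) ℂ) :
    HoldsGenerically fun a : α → ℂ => ∃ H : MvPolynomial β ℂ, H ≠ 0 ∧
      ∀ x ∈ T, ∀ r, (∀ q, aeval (Sum.elim x r) (A q) = a q) →
        aeval (fun j => aeval (Sum.elim x r) (y j)) H = 0 := by
  refine (holdsGenerically_exists_relation (restrictCoord ρ T ∘ y) (restrictCoord ρ T ∘ A)
    ((ringKrullDim_restrictCoord_le hT).trans_lt (by exact_mod_cast hd))).mono ?_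
  rintro a ⟨H, hH0, hH⟩
  refine ⟨H, hH0, fun x hx r hr => ?_⟩
  have := hH (aevalTower (evalCoord T x hx) r) (funext fun q => by
    simp only [Function.comp_apply, aevalTower_restrictCoord, hr])
  simpa only [Function.comp_def, aevalTower_restrictCoord] using this

theorem holdsGenerically_relation_on_hypersurface {α β : Type} [Finite α] [Finite β]
    {T : Set (σ → ℂ)} {d : ℕ}
    (hT : ringKrullDim (MvPolynomial σ ℂ ⧸ vanishingIdeal ℂ T) ≤ d)
    (hd : d + Nat.card ρ ≤ Nat.card β + Nat.card α)
    (y : β → MvPolynomial (σ ⊕ ρ) ℂ) (A : α → MvPolynomial (σ ⊕ ρ) ℂ)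
    {h : MvPolynomial (σ ⊕ ρ) ℂ} (hh : ∀ x ∈ T, ∃ r, aeval (Sum.elim x r) h ≠ 0) :
    HoldsGenerically fun a : α → ℂ => ∃ H : MvPolynomial β ℂ, H ≠ 0 ∧
      ∀ x ∈ T, ∀ r, aeval (Sum.elim x r) h = 0 → (∀ q, aeval (Sum.elim x r) (A q) = a q) →
        aeval (fun j => aeval (Sum.elim x r) (y j)) H = 0 := by
  refine (holdsGenerically_exists_relation_of_nonZeroDivisor (restrictCoord ρ T ∘ y)
    (restrictCoord ρ T ∘ A) (eq_zero_of_mul_restrictCoord_eq_zero hh)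
    ((ringKrullDim_restrictCoord_le hT).trans (by exact_mod_cast hd))).mono ?_
  rintro a ⟨H, hH0, hH⟩
  refine ⟨H, hH0, fun x hx r hr0 hr => ?_⟩
  have := hH (aevalTower (evalCoord T x hx) r) (by rw [aevalTower_restrictCoord, hr0])
    (funext fun q => by simp only [Function.comp_apply, aevalTower_restrictCoord, hr])
  simpa only [Function.comp_def, aevalTower_restrictCoord] using this

end Relations

section PolarMatrix

open scoped Matrix

variable {n p M : ℕ} {κ A B : Type} [CommRing A] [Algebra ℂ A] [CommRing B] [Algebra ℂ B]

/-- The matrix `J(x)` with the rows `b k - x` appended. -/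
noncomputable def polarMatrix (J : Matrix (Fin p) (Fin n) (MvPolynomial (Fin n) ℂ))
    (x : Fin n → A) (b : κ → Fin n → A) : Matrix (Fin p ⊕ κ) (Fin n) A :=
  Matrix.fromRows (Matrix.of fun j l => aeval x (J j l)) (Matrix.of fun k l => b k l - x l)

theorem map_polarMatrix_apply (J : Matrix (Fin p) (Fin n) (MvPolynomial (Fin n) ℂ))
    (φ : A →ₐ[ℂ] B) (x : Fin n → A) (b : κ → Fin n → A) (q : Fin p ⊕ κ) (l : Fin n) :
    φ (polarMatrix J x b q l) =
      polarMatrix J (fun j => φ (x j)) (fun k j => φ (b k j)) q l := by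
  rcases q with j | k
  · simp [polarMatrix, comp_aeval_apply]
  · simp [polarMatrix]

theorem map_vecMul_polarMatrix [Fintype κ]
    (J : Matrix (Fin p) (Fin n) (MvPolynomial (Fin n) ℂ))
    (φ : A →ₐ[ℂ] B) (r : Fin p ⊕ κ → A) (x : Fin n → A) (b : κ → Fin n → A) (l : Fin n) :
    φ ((r ᵥ* polarMatrix J x b) l) =
      ((fun q => φ (r q)) ᵥ* polarMatrix J (fun j => φ (x j)) (fun k j => φ (b k j))) l := by
  simp only [Matrix.vecMul, dotProduct, map_sum, map_mul, map_polarMatrix_apply]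

theorem map_det_polarMatrix [Fintype κ] [DecidableEq κ]
    (J : Matrix (Fin p) (Fin n) (MvPolynomial (Fin n) ℂ))
    (φ : A →ₐ[ℂ] B) (x : Fin n → A) (b : κ → Fin n → A) (c : Fin p ⊕ κ → Fin n) :
    φ ((polarMatrix J x b).submatrix id c).det =
      ((polarMatrix J (fun j => φ (x j)) (fun k j => φ (b k j))).submatrix id c).det := by
  rw [AlgHom.map_det]
  congr 1
  ext q l
  exact map_polarMatrix_apply J φ x b q (c l)

/-- The affine chart, indexed by the row `k₀`, of the incidence variety over the polar variety:
`a k₀ - x` is the combination with coefficients `r` of the rows of `J(x)` and of the remaining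
rows `a k - x`. -/
def ChartEq (J : Matrix (Fin p) (Fin n) (MvPolynomial (Fin n) ℂ)) (k₀ : Fin (M + 1))
    (a : Fin (M + 1) × Fin n → A) (x : Fin n → A) (r : Fin p ⊕ Fin M → A) : Prop :=
  ∀ l, a (k₀, l) = x l + (r ᵥ* polarMatrix J x fun k l => a (k₀.succAbove k, l)) l

/-- The family of polynomials parametrizing the matrices `a` that satisfy `ChartEq`. -/
noncomputable def chartParam (J : Matrix (Fin p) (Fin n) (MvPolynomial (Fin n) ℂ))
    (k₀ : Fin (M + 1)) (q : Fin (M + 1) × Fin n) :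
    MvPolynomial (Fin n ⊕ ((Fin p ⊕ Fin M) ⊕ (Fin M × Fin n))) ℂ :=
  (Fin.insertNth k₀
    (fun l => X (Sum.inl l) + ((fun q => X (Sum.inr (Sum.inl q))) ᵥ*
      polarMatrix J (fun l => X (Sum.inl l)) fun k l => X (Sum.inr (Sum.inr (k, l)))) l)
    (fun k l => X (Sum.inr (Sum.inr (k, l)))) :
      Fin (M + 1) → Fin n → MvPolynomial (Fin n ⊕ ((Fin p ⊕ Fin M) ⊕ (Fin M × Fin n))) ℂ) q.1 q.2

theorem aeval_chartParam {J : Matrix (Fin p) (Fin n) (MvPolynomial (Fin n) ℂ)}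
    {k₀ : Fin (M + 1)} {a : Fin (M + 1) × Fin n → ℂ} {x : Fin n → ℂ} {r : Fin p ⊕ Fin M → ℂ}
    (h : ChartEq J k₀ a x r) (q : Fin (M + 1) × Fin n) :
    aeval (Sum.elim x (Sum.elim r fun q => a (k₀.succAbove q.1, q.2))) (chartParam J k₀ q) =
      a q := by
  obtain ⟨k, l⟩ := q
  revert k
  rw [Fin.forall_iff_succAbove k₀]
  refine ⟨?_, fun k => ?_⟩
  · rw [h l]
    simp only [chartParam, Fin.insertNth_apply_same, map_add, map_vecMul_polarMatrix, aeval_X,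
      Sum.elim_inl, Sum.elim_inr]
  · simp [chartParam]

theorem holdsGenerically_relation_X {S : Set (Fin n → ℂ)} {d : ℕ}
    (hS : ringKrullDim (MvPolynomial (Fin n) ℂ ⧸ vanishingIdeal ℂ S) ≤ d) (hd : d + p = n)
    (J : Matrix (Fin p) (Fin n) (MvPolynomial (Fin n) ℂ)) (k₀ : Fin (M + 1))
    (t : Fin (M + 1) → Fin n) :
    HoldsGenerically fun a : Fin (M + 1) × Fin n → ℂ =>
      ∃ H : MvPolynomial (Fin (M + 1)) ℂ, H ≠ 0 ∧
        ∀ x ∈ S, ∀ r, ChartEq J k₀ a x r → aeval (x ∘ t) H = 0 := by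
  refine (holdsGenerically_relation_on (ρ := (Fin p ⊕ Fin M) ⊕ (Fin M × Fin n)) hS ?_
    (fun j => X (Sum.inl (t j))) (chartParam J k₀)).mono ?_
  · simp only [Nat.card_sum, Nat.card_prod, Nat.card_fin]
    nlinarith
  · rintro a ⟨H, hH0, hH⟩
    refine ⟨H, hH0, fun x hx r hr => ?_⟩
    simpa [Function.comp_def] using hH x hx _ (aeval_chartParam hr)

theorem holdsGenerically_relation_minor {S : Set (Fin n → ℂ)} {d : ℕ}
    (hS : ringKrullDim (MvPolynomial (Fin n) ℂ ⧸ vanishingIdeal ℂ S) ≤ d) (hd : d + p = n)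
    (J : Matrix (Fin p) (Fin n) (MvPolynomial (Fin n) ℂ)) (k₀ : Fin (M + 1))
    {c : Fin p ⊕ Fin M → Fin n} (hc : Function.Injective c)
    (t : Fin M → Fin n ⊕ (Fin p ⊕ Fin M)) :
    HoldsGenerically fun a : Fin (M + 1) × Fin n → ℂ =>
      ∃ H : MvPolynomial (Fin M) ℂ, H ≠ 0 ∧
        ∀ x ∈ S, aeval x (J.submatrix id (c ∘ Sum.inl)).det ≠ 0 → ∀ r, ChartEq J k₀ a x r →
          ((polarMatrix J x fun k l => a (k₀.succAbove k, l)).submatrix id c).det = 0 →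
          aeval (Sum.elim x r ∘ t) H = 0 := by
  set T := {x ∈ S | aeval x (J.submatrix id (c ∘ Sum.inl)).det ≠ 0}
  have hT : ringKrullDim (MvPolynomial (Fin n) ℂ ⧸ vanishingIdeal ℂ T) ≤ d :=
    (ringKrullDim_le_of_surjective
      (Ideal.Quotient.factor (vanishingIdeal_anti_mono fun _ hx => hx.1))
      (Ideal.Quotient.factor_surjective _)).trans hS
  refine (holdsGenerically_relation_on_hypersurface (ρ := (Fin p ⊕ Fin M) ⊕ (Fin M × Fin n)) hT ?_
    (fun j => Sum.elim (fun l => X (Sum.inl l)) (fun q => X (Sum.inr (Sum.inl q))) (t j))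
    (chartParam J k₀)
    (h := ((polarMatrix J (fun l => X (Sum.inl l))
      fun (k : Fin M) l => X (Sum.inr (Sum.inr (k, l)))).submatrix id c).det) ?_).mono ?_
  · simp only [Nat.card_sum, Nat.card_prod, Nat.card_fin]
    nlinarith
  · intro x hx
    refine ⟨Sum.elim 0 fun q => x q.2 + if c (Sum.inr q.1) = q.2 then 1 else 0, ?_⟩
    rw [map_det_polarMatrix]
    have hblock : (polarMatrix J x fun (k : Fin M) l => x l + if c (Sum.inr k) = l then 1 else 0).submatrix id c =
        Matrix.fromBlocks ((J.submatrix id (c ∘ Sum.inl)).map (aeval x))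
          (Matrix.of fun j k => aeval x (J j (c (Sum.inr k)))) 0 1 := by
      ext q q'
      rcases q with j | k <;> rcases q' with j' | k'
      · simp [polarMatrix]
      · simp [polarMatrix]
      · simp [polarMatrix, hc.eq_iff]
      · simp [polarMatrix, hc.eq_iff, Matrix.one_apply]
    simp only [aeval_X, Sum.elim_inl, Sum.elim_inr]
    rw [hblock, Matrix.det_fromBlocks_zero₂₁, Matrix.det_one, mul_one]
    have := hx.2
    rwa [AlgHom.map_det] at this
  · rintro a ⟨H, hH0, hH⟩
    refine ⟨H, hH0, fun x hx hδ r hr h0 => ?_⟩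
    have h1 := hH x ⟨hx, hδ⟩ _ (by rw [map_det_polarMatrix]; simpa using h0) (aeval_chartParam hr)
    convert h1 using 3
    funext j
    simp only [Function.comp_apply]
    rcases t j with l | q <;> simp

end PolarMatrix

section LinearAlgebra

open scoped Matrix

theorem Matrix.rank_lt_card_iff_exists_vecMul_eq_zero {K m n : Type*} [Field K] [Fintype m]
    [Fintype n] (N : Matrix m n K) :
    N.rank < Fintype.card m ↔ ∃ v, v ≠ 0 ∧ v ᵥ* N = 0 := by
  have h1 : N.rank = Fintype.card m ↔ Function.Injective N.vecMul := by
    rw [Matrix.vecMul_injective_iff, linearIndependent_iff_card_eq_finrank_span,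
      N.rank_eq_finrank_span_row, eq_comm]
    rfl
  rw [lt_iff_le_and_ne, and_iff_right N.rank_le_card_height, ne_eq, h1]
  have h2 : Function.Injective N.vecMul ↔ ∀ v, v ᵥ* N = 0 → v = 0 :=
    injective_iff_map_eq_zero N.vecMulLinear
  rw [h2]
  push Not
  exact exists_congr fun v => and_comm

theorem Matrix.exists_injective_det_submatrix_ne_zero {K n : Type*} [Field K] [Fintype n] {p : ℕ}
    {N : Matrix (Fin p) n K} (h : N.rank = p) :
    ∃ c : Fin p → n, Function.Injective c ∧ (N.submatrix id c).det ≠ 0 := by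
  obtain ⟨κ, c, hc, hspan, hli⟩ := exists_linearIndependent' K N.col
  have := Finite.of_injective c hc
  have := Fintype.ofFinite κ
  have hcard : Fintype.card κ = p := by
    rw [linearIndependent_iff_card_eq_finrank_span.mp hli, Set.finrank, hspan,
      ← N.rank_eq_finrank_span_cols, h]
  let e : Fin p ≃ κ := (Fintype.equivFinOfCardEq hcard).symm
  refine ⟨c ∘ e, hc.comp e.injective, ?_⟩
  have hli' : LinearIndependent K (N.submatrix id (c ∘ e))ᵀ.row := hli.comp e e.injective
  rw [← Matrix.det_transpose]
  exact ((Matrix.isUnit_iff_isUnit_det _).mp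
    (Matrix.linearIndependent_rows_iff_isUnit.mp hli')).ne_zero

theorem Matrix.rank_eq_of_det_submatrix_ne_zero {K n : Type*} [Field K] [Fintype n] {p : ℕ}
    {N : Matrix (Fin p) n K} {c : Fin p → n} (h : (N.submatrix id c).det ≠ 0) : N.rank = p := by
  refine le_antisymm (by simpa using N.rank_le_card_height) ?_
  have h1 := Matrix.rank_submatrix_le N id c
  rw [Matrix.rank_of_det_ne_zero h, Fintype.card_fin] at h1
  exact h1

variable {n p M : ℕ}

/-- The points `x` of `S` with `J(x)` of full rank at which the matrix `J(x)` with the rows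
`a k - x` appended is rank deficient. -/
def polarLocus (S : Set (Fin n → ℂ)) (J : Matrix (Fin p) (Fin n) (MvPolynomial (Fin n) ℂ))
    (a : Fin (M + 1) × Fin n → ℂ) : Set (Fin n → ℂ) :=
  {x | x ∈ S ∧ (J.map (aeval x)).rank = p ∧
    (polarMatrix J x fun k l => a (k, l)).rank ≤ p + M}

variable {J : Matrix (Fin p) (Fin n) (MvPolynomial (Fin n) ℂ)} {k₀ : Fin (M + 1)}
  {a : Fin (M + 1) × Fin n → ℂ} {x : Fin n → ℂ} {r : Fin p ⊕ Fin M → ℂ}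

theorem rank_polarMatrix_le_iff :
    (polarMatrix J x fun k l => a (k, l)).rank ≤ p + M ↔
      ∃ (u : Fin p → ℂ) (w : Fin (M + 1) → ℂ), (u ≠ 0 ∨ w ≠ 0) ∧
        ∀ l, ∑ j, u j * aeval x (J j l) + ∑ k, w k * (a (k, l) - x l) = 0 := by
  rw [← Nat.lt_add_one_iff, add_assoc,
    show p + (M + 1) = Fintype.card (Fin p ⊕ Fin (M + 1)) by simp,
    Matrix.rank_lt_card_iff_exists_vecMul_eq_zero]
  constructor
  · rintro ⟨v, hv, h0⟩
    refine ⟨v ∘ Sum.inl, v ∘ Sum.inr, ?_, fun l => ?_⟩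
    · by_contra! h
      apply hv
      ext (j | k)
      · exact congrFun h.1 j
      · exact congrFun h.2 k
    · simpa [polarMatrix, Matrix.vecMul, dotProduct] using congrFun h0 l
  · rintro ⟨u, w, huw, h0⟩
    refine ⟨Sum.elim u w, ?_, ?_⟩
    · intro h
      rcases huw with hu | hw
      · exact hu (funext fun j => congrFun h (Sum.inl j))
      · exact hw (funext fun k => congrFun h (Sum.inr k))
    · ext l
      simpa [polarMatrix, Matrix.vecMul, dotProduct] using h0 l

theorem chartEq_iff : ChartEq J k₀ a x r ↔ ∀ l, a (k₀, l) - x l =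
    ∑ j, r (Sum.inl j) * aeval x (J j l) +
      ∑ k, r (Sum.inr k) * (a (k₀.succAbove k, l) - x l) := by
  refine forall_congr' fun l => ?_
  rw [sub_eq_iff_eq_add']
  simp [polarMatrix, Matrix.vecMul, dotProduct]

theorem ChartEq.rank_polarMatrix_le (h : ChartEq J k₀ a x r) :
    (polarMatrix J x fun k l => a (k, l)).rank ≤ p + M := by
  rw [chartEq_iff] at h
  rw [rank_polarMatrix_le_iff]
  refine ⟨r ∘ Sum.inl, Fin.insertNth k₀ (-1 : ℂ) (r ∘ Sum.inr), Or.inr fun h0 => ?_, fun l => ?_⟩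
  · simpa using congrFun h0 k₀
  · rw [Fin.sum_univ_succAbove _ k₀]
    simp only [Fin.insertNth_apply_same, Fin.insertNth_apply_succAbove, h l, Function.comp_apply]
    ring

theorem exists_chartEq_of_mem_polarLocus {S : Set (Fin n → ℂ)} (h : x ∈ polarLocus S J a) :
    ∃ (k₀ : Fin (M + 1)) (r : Fin p ⊕ Fin M → ℂ), ChartEq J k₀ a x r := by
  obtain ⟨-, hJ, h⟩ := h
  obtain ⟨u, w, huw, h0⟩ := rank_polarMatrix_le_iff.mp h
  have hw : w ≠ 0 := by
    rintro rfl
    have hu : u ≠ 0 := by simpa using huw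
    have := (Matrix.rank_lt_card_iff_exists_vecMul_eq_zero (J.map (aeval x))).mpr
      ⟨u, hu, funext fun l => by simpa [Matrix.vecMul, dotProduct] using h0 l⟩
    rw [hJ, Fintype.card_fin] at this
    exact this.false
  obtain ⟨k₀, hk⟩ := Function.ne_iff.mp hw
  refine ⟨k₀, Sum.elim (fun j => -(w k₀)⁻¹ * u j) (fun k => -(w k₀)⁻¹ * w (k₀.succAbove k)),
    chartEq_iff.mpr fun l => ?_⟩
  have h1 := h0 l
  rw [Fin.sum_univ_succAbove _ k₀] at h1
  simp only [Sum.elim_inl, Sum.elim_inr, mul_assoc, ← Finset.mul_sum]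
  have hk' : w k₀ ≠ 0 := hk
  field_simp
  linear_combination h1

end LinearAlgebra

section Dimension

theorem ringKrullDim_quotient_le_of_relations {σ : Type} [Finite σ] {T : Set (σ → ℂ)} {d : ℕ}
    (h : ∀ t : Fin (d + 1) → σ, ∃ H : MvPolynomial (Fin (d + 1)) ℂ, H ≠ 0 ∧
      ∀ x ∈ T, aeval (x ∘ t) H = 0)
    {P : Ideal (MvPolynomial σ ℂ)} [P.IsPrime] (hP : vanishingIdeal ℂ T ≤ P) :
    ringKrullDim (MvPolynomial σ ℂ ⧸ P) ≤ d := by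
  by_contra! hlt
  have hd : ((d + 1 : ℕ) : WithBot ℕ∞) ≤ ringKrullDim (MvPolynomial σ ℂ ⧸ P) := by
    obtain ⟨s, hs, -⟩ := exists_ringKrullDim_eq_and_trdeg_eq ℂ (MvPolynomial σ ℂ ⧸ P)
    rw [hs] at hlt ⊢
    exact_mod_cast hlt
  have htop : Algebra.adjoin ℂ (Set.range (Ideal.Quotient.mkₐ ℂ P ∘ X)) = ⊤ := by
    rw [Set.range_comp, ← AlgHom.map_adjoin, MvPolynomial.adjoin_range_X, Algebra.map_top,
      AlgHom.range_eq_top]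
    exact Ideal.Quotient.mkₐ_surjective ℂ P
  have : Algebra.IsAlgebraic (Algebra.adjoin ℂ (Set.range (Ideal.Quotient.mkₐ ℂ P ∘ X)))
      (MvPolynomial σ ℂ ⧸ P) := by
    rw [htop]
    exact ⟨fun v => isAlgebraic_algebraMap (⟨v, trivial⟩ : (⊤ : Subalgebra ℂ _))⟩
  obtain ⟨t, ht⟩ := exists_algebraicIndependent_X (k := ℂ) (Ideal.Quotient.mkₐ ℂ P ∘ X) hd
  obtain ⟨H, hH0, hH⟩ := h t
  refine hH0 (ht.eq_zero_of_aeval_eq_zero H ?_)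
  have h1 : aeval (X ∘ t) H ∈ P := hP fun x hx => by
    rw [comp_aeval_apply]
    simpa [Function.comp_def] using hH x hx
  rw [← Ideal.Quotient.eq_zero_iff_mem, ← Ideal.Quotient.mkₐ_eq_mk ℂ, comp_aeval_apply] at h1
  exact h1

theorem le_ringKrullDim_quotient_ker {σ D : Type} [Finite σ] [CommRing D] [IsDomain D] [Algebra ℂ D]
    [Algebra.FiniteType ℂ D] (ψ : MvPolynomial σ ℂ →ₐ[ℂ] D) [Algebra.IsAlgebraic ψ.range D] {d : ℕ}
    (hd : (d : WithBot ℕ∞) ≤ ringKrullDim D) :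
    (d : WithBot ℕ∞) ≤ ringKrullDim (MvPolynomial σ ℂ ⧸ RingHom.ker ψ) := by
  have hr : Algebra.adjoin ℂ (Set.range (ψ ∘ X)) = ψ.range := by
    rw [Set.range_comp, ← AlgHom.map_adjoin, MvPolynomial.adjoin_range_X, Algebra.map_top]
  have : Algebra.IsAlgebraic (Algebra.adjoin ℂ (Set.range (ψ ∘ X))) D := by
    rw [hr]; infer_instance
  obtain ⟨t, ht⟩ := exists_algebraicIndependent_X (k := ℂ) (ψ ∘ X) hd
  have : AlgebraicIndependent ℂ (Ideal.Quotient.mkₐ ℂ (RingHom.ker ψ) ∘ X ∘ t) := by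
    refine AlgebraicIndependent.of_comp (Ideal.kerLiftAlg ψ) ?_
    exact ht
  simpa using this.natCard_le_ringKrullDim

theorem exists_mem_forall_minimalPrimes_eq {σ : Type} [Finite σ] {T : Set (σ → ℂ)}
    {P : Ideal (MvPolynomial σ ℂ)} (hP : P ∈ (vanishingIdeal ℂ T).minimalPrimes) :
    ∃ x ∈ T, ∀ P' ∈ (vanishingIdeal ℂ T).minimalPrimes, P' ≤ vanishingIdeal ℂ {x} → P' = P := by
  classical
  have hPp : P.IsPrime := hP.1.1
  have hfin : ((vanishingIdeal ℂ T).minimalPrimes \ {P}).Finite :=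
    (Ideal.finite_minimalPrimes_of_isNoetherianRing _ _).sdiff
  have hex : ∀ P' ∈ hfin.toFinset, ∃ g ∈ P', g ∉ P := by
    intro P' hP'
    rw [Set.Finite.mem_toFinset] at hP'
    by_contra! hle
    exact hP'.2 (le_antisymm hle (hP.2 hP'.1.1 hle))
  choose! g hg hgP using hex
  have hprod : ∏ P' ∈ hfin.toFinset, g P' ∉ P := by
    rw [hPp.prod_mem_iff]
    push Not
    exact hgP
  have : ∏ P' ∈ hfin.toFinset, g P' ∉ vanishingIdeal ℂ T := fun h => hprod (hP.1.2 h)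
  rw [mem_vanishingIdeal_iff] at this
  push Not at this
  obtain ⟨x, hx, h0⟩ := this
  refine ⟨x, hx, fun P' hP' hle => ?_⟩
  by_contra hne
  have hmem : P' ∈ hfin.toFinset := by simpa using ⟨hP', hne⟩
  rw [map_prod, Finset.prod_ne_zero_iff] at h0
  exact h0 P' hmem (hle (hg P' hmem) x rfl)

end Dimension

section Incidence

open scoped Matrix

theorem MvPolynomial.isAlgebraic_range_quotient {σ ρ : Type}
    {Q : Ideal (MvPolynomial (σ ⊕ ρ) ℂ)} [Q.IsPrime]
    (h : ∀ q, ∃ u v : MvPolynomial σ ℂ, rename Sum.inl u ∉ Q ∧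
      rename Sum.inl u * X (Sum.inr q) - rename Sum.inl v ∈ Q) :
    Algebra.IsAlgebraic ((Ideal.Quotient.mkₐ ℂ Q).comp (rename Sum.inl)).range
      (MvPolynomial (σ ⊕ ρ) ℂ ⧸ Q) := by
  set ψ := (Ideal.Quotient.mkₐ ℂ Q).comp (rename Sum.inl : MvPolynomial σ ℂ →ₐ[ℂ] _) with hψ
  refine ⟨fun z => ?_⟩
  obtain ⟨z, rfl⟩ := Ideal.Quotient.mkₐ_surjective ℂ Q z
  induction z using MvPolynomial.induction_on with
  | C a =>
    rw [← MvPolynomial.algebraMap_eq, AlgHom.commutes]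
    exact isAlgebraic_algebraMap (algebraMap ℂ ψ.range a)
  | add f g hf hg => rw [map_add]; exact hf.add hg
  | mul_X f j hf =>
    rw [map_mul]
    refine hf.mul ?_
    rcases j with l | q
    · have := isAlgebraic_algebraMap (A := MvPolynomial (σ ⊕ ρ) ℂ ⧸ Q)
        (⟨ψ (X l), X l, rfl⟩ : ψ.range)
      rwa [show algebraMap ψ.range _ ⟨ψ (X l), X l, rfl⟩ = ψ (X l) from rfl, hψ,
        AlgHom.comp_apply, rename_X] at this
    · obtain ⟨u, v, hu, huv⟩ := h q
      have hu' : ψ u ≠ 0 := by rwa [hψ, AlgHom.comp_apply, Ideal.Quotient.mkₐ_eq_mk, ne_eq,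
        Ideal.Quotient.eq_zero_iff_mem]
      have huv' : ψ u * Ideal.Quotient.mkₐ ℂ Q (X (Sum.inr q)) = ψ v := by
        rw [← sub_eq_zero, hψ, AlgHom.comp_apply, AlgHom.comp_apply, ← map_mul, ← map_sub,
          Ideal.Quotient.mkₐ_eq_mk, Ideal.Quotient.eq_zero_iff_mem]
        exact huv
      refine ⟨Polynomial.C (⟨ψ u, u, rfl⟩ : ψ.range) * Polynomial.X -
        Polynomial.C ⟨ψ v, v, rfl⟩, fun h0 => hu' ?_, ?_⟩
      · have := congrArg (Polynomial.coeff · 1) h0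
        simpa [Polynomial.coeff_C, Subtype.ext_iff] using this
      · simp only [map_sub, map_mul, Polynomial.aeval_C, Polynomial.aeval_X]
        rw [sub_eq_zero]
        exact huv'

theorem Function.Injective.exists_injective_extend_sum {α β ι : Type} [Fintype α] [Fintype β]
    [Fintype ι] {c : α → ι} (hc : Function.Injective c)
    (h : Fintype.card α + Fintype.card β ≤ Fintype.card ι) :
    ∃ c' : α ⊕ β → ι, Function.Injective c' ∧ c' ∘ Sum.inl = c := by
  classical
  have h1 : Fintype.card β ≤ Fintype.card {y // y ∉ Set.range c} := by
    rw [Fintype.card_subtype_compl, show Fintype.card {y // y ∈ Set.range c} = Fintype.card α from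
      Set.card_range_of_injective hc]
    omega
  obtain ⟨e⟩ := Function.Embedding.nonempty_of_card_le h1
  refine ⟨Sum.elim c fun k => e k, hc.sumElim (Subtype.val_injective.comp e.injective) ?_,
    Sum.elim_comp_inl _ _⟩
  intro j k hjk
  exact (e k).2 ⟨j, hjk⟩

/-- The equations, in the unknowns `x` and `r`, of the incidence variety `ChartEq` over the
variety `f = 0`. -/
noncomputable def incidenceEqs {n p M : ℕ} (f : Fin p → MvPolynomial (Fin n) ℂ)
    (J : Matrix (Fin p) (Fin n) (MvPolynomial (Fin n) ℂ)) (k₀ : Fin (M + 1))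
    (a : Fin (M + 1) × Fin n → ℂ) :
    Fin p ⊕ Fin n → MvPolynomial (Fin n ⊕ (Fin p ⊕ Fin M)) ℂ :=
  Sum.elim (fun j => rename Sum.inl (f j)) fun l =>
    X (Sum.inl l) + ((fun q => X (Sum.inr q)) ᵥ* polarMatrix J (fun l => X (Sum.inl l))
      fun (k : Fin M) l => C (a (k₀.succAbove k, l))) l - C (a (k₀, l))

variable {n p M : ℕ} {f : Fin p → MvPolynomial (Fin n) ℂ}
    {J : Matrix (Fin p) (Fin n) (MvPolynomial (Fin n) ℂ)} {k₀ : Fin (M + 1)}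
    {a : Fin (M + 1) × Fin n → ℂ}

theorem forall_aeval_incidenceEqs_eq_zero_iff (z : Fin n ⊕ (Fin p ⊕ Fin M) → ℂ) :
    (∀ q, aeval z (incidenceEqs f J k₀ a q) = 0) ↔
      (∀ j, aeval (z ∘ Sum.inl) (f j) = 0) ∧ ChartEq J k₀ a (z ∘ Sum.inl) (z ∘ Sum.inr) := by
  rw [Sum.forall]
  refine and_congr (forall_congr' fun j => ?_) (forall_congr' fun l => ?_)
  · simp [incidenceEqs, aeval_rename]
  · simp only [incidenceEqs, Sum.elim_inr, map_sub, map_add, map_vecMul_polarMatrix, aeval_X,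
      aeval_C, Algebra.algebraMap_self, RingHom.id_apply]
    rw [sub_eq_zero, eq_comm]
    rfl

/-- The columns `c` of the matrix of `ChartEq`, as a matrix of polynomials in `x`. -/
noncomputable def chartMinor (J : Matrix (Fin p) (Fin n) (MvPolynomial (Fin n) ℂ))
    (k₀ : Fin (M + 1)) (a : Fin (M + 1) × Fin n → ℂ) (c : Fin p ⊕ Fin M → Fin n) :
    Matrix (Fin p ⊕ Fin M) (Fin p ⊕ Fin M) (MvPolynomial (Fin n) ℂ) :=
  (polarMatrix J X fun k l => C (a (k₀.succAbove k, l))).submatrix id c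

theorem aeval_det_chartMinor (c : Fin p ⊕ Fin M → Fin n) (x : Fin n → ℂ) :
    aeval x (chartMinor J k₀ a c).det =
      ((polarMatrix J x fun k l => a (k₀.succAbove k, l)).submatrix id c).det := by
  rw [chartMinor, map_det_polarMatrix]
  simp

theorem rename_det_chartMinor_mul_X_sub (c : Fin p ⊕ Fin M → Fin n) (q : Fin p ⊕ Fin M) :
    rename Sum.inl (chartMinor J k₀ a c).det * X (Sum.inr q) -
      rename Sum.inl (((fun q => C (a (k₀, c q)) - X (c q)) ᵥ* (chartMinor J k₀ a c).adjugate) q) ∈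
      Ideal.span (Set.range (incidenceEqs f J k₀ a)) := by
  set N := (polarMatrix J (fun l => X (Sum.inl l))
      fun (k : Fin M) l => C (a (k₀.succAbove k, l))).submatrix id c with hN
  have hN' : (rename Sum.inl : MvPolynomial (Fin n) ℂ →ₐ[ℂ]
      MvPolynomial (Fin n ⊕ (Fin p ⊕ Fin M)) ℂ).mapMatrix (chartMinor J k₀ a c) = N := by
    ext1 q q'
    rw [AlgHom.mapMatrix_apply, Matrix.map_apply, chartMinor, Matrix.submatrix_apply,
      map_polarMatrix_apply]
    simp [hN]
  have h1 : ∀ v : Fin p ⊕ Fin M → MvPolynomial (Fin n ⊕ (Fin p ⊕ Fin M)) ℂ,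
      v ᵥ* N ᵥ* N.adjugate = N.det • v := fun v => by
    rw [Matrix.vecMul_vecMul, Matrix.mul_adjugate, Matrix.vecMul_smul, Matrix.vecMul_one]
  have h2 : ∀ q' : Fin p ⊕ Fin M, ((fun q => X (Sum.inr q)) ᵥ* N) q' =
      incidenceEqs f J k₀ a (Sum.inr (c q')) - X (Sum.inl (c q')) + C (a (k₀, c q')) := fun q' => by
    simp only [incidenceEqs, Sum.elim_inr]
    have : ((fun q => X (Sum.inr q)) ᵥ* N) q' = ((fun q => X (Sum.inr q)) ᵥ*
      polarMatrix J (fun l => X (Sum.inl l))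
      fun (k : Fin M) l => C (a (k₀.succAbove k, l))) (c q') := rfl
    rw [this]
    ring
  rw [AlgHom.map_det, hN']
  have h3 := congrFun (h1 fun q => X (Sum.inr q)) q
  simp only [Pi.smul_apply, smul_eq_mul] at h3
  rw [← h3]
  simp only [Matrix.vecMul, dotProduct, map_sum, map_mul, map_sub, rename_C, rename_X]
  simp only [Matrix.vecMul, dotProduct] at h2
  rw [← Finset.sum_sub_distrib]
  refine Ideal.sum_mem _ fun q' _ => ?_
  have h4 : rename Sum.inl ((chartMinor J k₀ a c).adjugate q' q) = N.adjugate q' q := by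
    rw [← hN', ← AlgHom.map_adjugate]; rfl
  rw [h4, h2, ← sub_mul]
  refine Ideal.mul_mem_right _ _ ?_
  ring_nf
  exact Ideal.subset_span ⟨_, rfl⟩

end Incidence

section PolarDimension

open scoped Matrix

variable {n p M : ℕ} {f : Fin p → MvPolynomial (Fin n) ℂ}
    {J : Matrix (Fin p) (Fin n) (MvPolynomial (Fin n) ℂ)} {k₀ : Fin (M + 1)}
    {a : Fin (M + 1) × Fin n → ℂ}

/-- For fixed `a`, the points of `S` on the chart `k₀` where the minor with columns `c` vanishes
satisfy a nontrivial relation between any `M` coordinates. -/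
def MinorRelations (S : Set (Fin n → ℂ)) (J : Matrix (Fin p) (Fin n) (MvPolynomial (Fin n) ℂ))
    (a : Fin (M + 1) × Fin n → ℂ) (k₀ : Fin (M + 1)) (c : Fin p ⊕ Fin M → Fin n)
    (t : Fin M → Fin n ⊕ (Fin p ⊕ Fin M)) : Prop :=
  ∃ H : MvPolynomial (Fin M) ℂ, H ≠ 0 ∧
    ∀ x ∈ S, aeval x (J.submatrix id (c ∘ Sum.inl)).det ≠ 0 → ∀ r, ChartEq J k₀ a x r →
      ((polarMatrix J x fun k l => a (k₀.succAbove k, l)).submatrix id c).det = 0 →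
      aeval (Sum.elim x r ∘ t) H = 0

theorem exists_isPrime_le_vanishingIdeal_singleton_of_mem_polarLocus (hpM : p + M ≤ n)
    (hrel : ∀ k₀ (c : Fin p ⊕ Fin M → Fin n), Function.Injective c → ∀ t,
      MinorRelations {x : Fin n → ℂ | ∀ j, aeval x (f j) = 0} J a k₀ c t)
    {x : Fin n → ℂ} (hx : x ∈ polarLocus {x : Fin n → ℂ | ∀ j, aeval x (f j) = 0} J a) :
    ∃ 𝔮 : Ideal (MvPolynomial (Fin n) ℂ), 𝔮.IsPrime ∧
      vanishingIdeal ℂ (polarLocus {x : Fin n → ℂ | ∀ j, aeval x (f j) = 0} J a) ≤ 𝔮 ∧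
      𝔮 ≤ vanishingIdeal ℂ {x} ∧ (M : WithBot ℕ∞) ≤ ringKrullDim (MvPolynomial (Fin n) ℂ ⧸ 𝔮) := by
  obtain ⟨k₀, r, hr⟩ := exists_chartEq_of_mem_polarLocus hx
  obtain ⟨c₀, hc₀, hδ⟩ := Matrix.exists_injective_det_submatrix_ne_zero hx.2.1
  obtain ⟨c, hc, hcl⟩ := hc₀.exists_injective_extend_sum (β := Fin M) (by simpa using hpM)
  obtain ⟨Q, hQ, hsQ, hQx, hdim⟩ := exists_isPrime_le_card_add_ringKrullDim (Sum.elim x r)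
    (Set.range (incidenceEqs f J k₀ a)) (r := p + n) (d := M)
    (by
      rw [← Set.image_univ]
      refine (Set.encard_image_le _ _).trans ?_
      simp [Set.encard_univ])
    (by
      rw [Set.forall_mem_range, forall_aeval_incidenceEqs_eq_zero_iff]
      exact ⟨hx.1, hr⟩)
    (by simp only [Nat.card_sum, Nat.card_fin]; omega)
  set δ := (J.submatrix id c₀).det with hδ_def
  have hδ' : ∀ y : Fin n → ℂ, aeval y δ = ((J.map (aeval y)).submatrix id c₀).det := fun y => by
    rw [hδ_def, AlgHom.map_det]; rfl
  have hδQ : rename Sum.inl δ ∉ Q := fun h => by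
    have := hQx h
    rw [mem_vanishingIdeal_singleton_iff, aeval_rename, Sum.elim_comp_inl, hδ'] at this
    exact hδ this
  have hzero : ∀ g, (∀ z : Fin n ⊕ (Fin p ⊕ Fin M) → ℂ, (∀ q, aeval z (incidenceEqs f J k₀ a q) = 0) → (∀ g ∈ Q, aeval z g = 0) →
      aeval (z ∘ Sum.inl) δ ≠ 0 → aeval z g = 0) → g ∈ Q := by
    intro g hg
    have h1 : rename Sum.inl δ * g ∈ vanishingIdeal ℂ (zeroLocus ℂ Q) := by
      intro z hz
      rw [map_mul, aeval_rename]
      by_cases h0 : aeval (z ∘ Sum.inl) δ = 0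
      · rw [h0, zero_mul]
      · rw [hg z (fun q => hz _ (hsQ ⟨q, rfl⟩)) hz h0, mul_zero]
    rw [MvPolynomial.IsPrime.vanishingIdeal_zeroLocus] at h1
    exact (hQ.mem_or_mem h1).resolve_left hδQ
  have hD : rename Sum.inl (chartMinor J k₀ a c).det ∉ Q := by
    intro hmem
    obtain ⟨t, ht⟩ := exists_algebraicIndependent_X (k := ℂ) (Ideal.Quotient.mkₐ ℂ Q ∘ X)
      (halg := by
        rw [Set.range_comp, ← AlgHom.map_adjoin, MvPolynomial.adjoin_range_X, Algebra.map_top,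
          (AlgHom.range_eq_top _).mpr (Ideal.Quotient.mkₐ_surjective ℂ Q)]
        exact ⟨fun v => isAlgebraic_algebraMap (⟨v, trivial⟩ : (⊤ : Subalgebra ℂ _))⟩) hdim
    obtain ⟨H, hH0, hH⟩ := hrel k₀ c hc t
    refine hH0 (ht.eq_zero_of_aeval_eq_zero H ?_)
    have h1 : aeval (X ∘ t) H ∈ Q := hzero _ fun z hz hzQ h0 => by
      rw [forall_aeval_incidenceEqs_eq_zero_iff] at hz
      have h2 := hzQ _ hmem
      rw [aeval_rename, aeval_det_chartMinor] at h2
      have h3 := hH _ hz.1 (by rwa [hcl]) _ hz.2 h2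
      rw [comp_aeval_apply]
      rw [Sum.elim_comp_inl_inr] at h3
      simpa [Function.comp_def] using h3
    rw [← Ideal.Quotient.eq_zero_iff_mem, ← Ideal.Quotient.mkₐ_eq_mk ℂ, comp_aeval_apply] at h1
    exact h1
  have halg := MvPolynomial.isAlgebraic_range_quotient (Q := Q) fun q =>
    ⟨_, _, hD, Ideal.span_le.mpr hsQ (rename_det_chartMinor_mul_X_sub c q)⟩
  have hker : ∀ g, g ∈ RingHom.ker ((Ideal.Quotient.mkₐ ℂ Q).comp
      (rename Sum.inl : MvPolynomial (Fin n) ℂ →ₐ[ℂ] _)) ↔ rename Sum.inl g ∈ Q := fun g => by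
    rw [RingHom.mem_ker, AlgHom.comp_apply, Ideal.Quotient.mkₐ_eq_mk,
      Ideal.Quotient.eq_zero_iff_mem]
  refine ⟨_, RingHom.ker_isPrime _, fun g hg => ?_, fun g hg => ?_,
    le_ringKrullDim_quotient_ker ((Ideal.Quotient.mkₐ ℂ Q).comp (rename Sum.inl)) hdim⟩
  · rw [hker]
    refine hzero _ fun z hz _ h0 => ?_
    rw [forall_aeval_incidenceEqs_eq_zero_iff] at hz
    rw [aeval_rename]
    refine hg _ ⟨hz.1, ?_, hz.2.rank_polarMatrix_le⟩
    rw [hδ'] at h0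
    exact Matrix.rank_eq_of_det_submatrix_ne_zero h0
  · have := hQx ((hker g).mp hg)
    rw [mem_vanishingIdeal_singleton_iff, aeval_rename, Sum.elim_comp_inl] at this
    exact (mem_vanishingIdeal_singleton_iff _ _).mpr this

theorem le_ringKrullDim_of_mem_minimalPrimes_polarLocus (hpM : p + M ≤ n)
    (hrel : ∀ k₀ (c : Fin p ⊕ Fin M → Fin n), Function.Injective c → ∀ t,
      MinorRelations {x : Fin n → ℂ | ∀ j, aeval x (f j) = 0} J a k₀ c t)
    {P : Ideal (MvPolynomial (Fin n) ℂ)}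
    (hP : P ∈ (vanishingIdeal ℂ (polarLocus {x : Fin n → ℂ | ∀ j, aeval x (f j) = 0} J a)).minimalPrimes) :
    (M : WithBot ℕ∞) ≤ ringKrullDim (MvPolynomial (Fin n) ℂ ⧸ P) := by
  obtain ⟨x, hx, huniq⟩ := exists_mem_forall_minimalPrimes_eq hP
  obtain ⟨𝔮, h𝔮, hle, hqx, hdim⟩ :=
    exists_isPrime_le_vanishingIdeal_singleton_of_mem_polarLocus hpM hrel hx
  obtain ⟨P', hP', hP'q⟩ := Ideal.exists_minimalPrimes_le hle
  obtain rfl := huniq P' hP' (hP'q.trans hqx)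
  exact hdim.trans (ringKrullDim_le_of_surjective (Ideal.Quotient.factor hP'q)
    (Ideal.Quotient.factor_surjective _))

theorem holdsGenerically_ringKrullDim_polarLocus {d : ℕ}
    (hS : ringKrullDim (MvPolynomial (Fin n) ℂ ⧸
      vanishingIdeal ℂ {x : Fin n → ℂ | ∀ j, aeval x (f j) = 0}) ≤ d) (hd : d + p = n) (hpM : p + M ≤ n) :
    HoldsGenerically fun a : Fin (M + 1) × Fin n → ℂ =>
      ∀ P ∈ (vanishingIdeal ℂ (polarLocus {x : Fin n → ℂ | ∀ j, aeval x (f j) = 0} J a)).minimalPrimes,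
        ringKrullDim (MvPolynomial (Fin n) ℂ ⧸ P) = M := by
  set S := {x : Fin n → ℂ | ∀ j, aeval x (f j) = 0} with hS_def
  have h1 := HoldsGenerically.forall fun q : Fin (M + 1) × (Fin (M + 1) → Fin n) =>
    holdsGenerically_relation_X hS hd J q.1 q.2
  have h2 : HoldsGenerically fun a : Fin (M + 1) × Fin n → ℂ =>
      ∀ q : Fin (M + 1) × {c : Fin p ⊕ Fin M → Fin n // Function.Injective c} ×
        (Fin M → Fin n ⊕ (Fin p ⊕ Fin M)), MinorRelations S J a q.1 q.2.1 q.2.2 :=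
    HoldsGenerically.forall fun q => holdsGenerically_relation_minor hS hd J q.1 q.2.1.2 q.2.2
  refine (h1.and h2).mono fun a ⟨hX, hM⟩ P hP => le_antisymm ?_ ?_
  · have := hP.1.1
    refine ringKrullDim_quotient_le_of_relations (fun t => ?_) hP.1.2
    choose H hH0 hH using fun k₀ => hX (k₀, t)
    refine ⟨∏ k₀, H k₀, Finset.prod_ne_zero_iff.mpr fun k₀ _ => hH0 k₀, fun x hx => ?_⟩
    obtain ⟨k₀, r, hr⟩ := exists_chartEq_of_mem_polarLocus hx
    rw [map_prod]
    exact Finset.prod_eq_zero (Finset.mem_univ k₀) (hH k₀ x hx.1 r hr)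
  · exact le_ringKrullDim_of_mem_minimalPrimes_polarLocus hpM
      (fun k₀ c hc t => hM (k₀, ⟨c, hc⟩, t)) hP

theorem holdsGenerically_rank_eq {m n : ℕ} (h : m ≤ n) :
    HoldsGenerically fun a : Fin m × Fin n → ℂ => (Matrix.of fun k l => a (k, l)).rank = m := by
  let e : Fin m × Fin m → Fin m × Fin n := Prod.map id (Fin.castLE h)
  refine ⟨rename e (Matrix.mvPolynomialX (Fin m) (Fin m) ℂ).det, ?_, fun a ha => ?_⟩
  · have he : Function.Injective e := Function.injective_id.prodMap (Fin.castLE_injective h)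
    exact ((rename_injective e he).ne_iff' (map_zero _)).mpr (Matrix.det_mvPolynomialX_ne_zero _ _)
  · refine Matrix.rank_eq_of_det_submatrix_ne_zero (c := Fin.castLE h) ?_
    rw [aeval_rename, AlgHom.map_det] at ha
    have hsub : (Matrix.of fun k l => a (k, l)).submatrix id (Fin.castLE h) =
        (aeval (a ∘ e)).mapMatrix (Matrix.mvPolynomialX (Fin m) (Fin m) ℂ) := by
      ext k l
      simp [e]
    rwa [hsub]

end PolarDimension

section RealPoints

open Topology

theorem MvPolynomial.hasStrictFDerivAt_eval {σ : Type} [Fintype σ] (g : MvPolynomial σ ℝ)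
    (x : σ → ℝ) :
    HasStrictFDerivAt (fun y : σ → ℝ => eval y g)
      (∑ l, eval x (pderiv l g) • (ContinuousLinearMap.proj l : (σ → ℝ) →L[ℝ] ℝ)) x := by
  classical
  induction g using MvPolynomial.induction_on with
  | C a => simpa using hasStrictFDerivAt_const a x
  | add f g hf hg =>
    simp only [map_add, add_smul, Finset.sum_add_distrib]
    exact hf.add hg
  | mul_X f j hf =>
    simp only [map_mul, eval_X]
    refine (hf.mul (hasStrictFDerivAt_apply j x)).congr_fderiv ?_
    ext v
    simp [pderiv_X, Pi.single_apply, add_mul, Finset.sum_add_distrib, Finset.mul_sum, apply_ite,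
      ite_mul, mul_assoc]

theorem exists_normal_through_nhds {n p : ℕ} {f : Fin p → MvPolynomial (Fin n) ℝ} {z : Fin n → ℝ}
    (hz : ∀ j, eval z (f j) = 0)
    (hrank : (Matrix.of fun j l => eval z (pderiv l (f j))).rank = p) :
    ∀ᶠ b in 𝓝 z, ∃ (x : Fin n → ℝ) (μ : Fin p → ℝ), (∀ j, eval x (f j) = 0) ∧
      (Matrix.of fun j l => eval x (pderiv l (f j))).rank = p ∧
      ∀ l, b l = x l + ∑ j, μ j * eval x (pderiv l (f j)) := by
  let G : (Fin n → ℝ) × (Fin p → ℝ) → (Fin p → ℝ) × (Fin n → ℝ) := fun y =>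
    (fun j => eval y.1 (f j), fun l => y.1 l + ∑ j, y.2 j * eval y.1 (pderiv l (f j)))
  let d (g : MvPolynomial (Fin n) ℝ) : (Fin n → ℝ) × (Fin p → ℝ) →L[ℝ] ℝ :=
    (∑ l, eval z (pderiv l g) • (ContinuousLinearMap.proj l : (Fin n → ℝ) →L[ℝ] ℝ)).comp
      (ContinuousLinearMap.fst ℝ _ _)
  have hd : ∀ g, HasStrictFDerivAt (fun y : (Fin n → ℝ) × (Fin p → ℝ) => eval y.1 g) (d g)
      (z, 0) := fun g =>
    HasStrictFDerivAt.comp (g := fun y => eval y g) (f := Prod.fst) (z, (0 : Fin p → ℝ))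
      (MvPolynomial.hasStrictFDerivAt_eval g z) hasStrictFDerivAt_fst
  let G' : (Fin n → ℝ) × (Fin p → ℝ) →L[ℝ] (Fin p → ℝ) × (Fin n → ℝ) :=
    (ContinuousLinearMap.pi fun j => d (f j)).prod (ContinuousLinearMap.pi fun l =>
      (ContinuousLinearMap.proj l).comp (ContinuousLinearMap.fst ℝ _ _) +
        ∑ j, eval z (pderiv l (f j)) •
          (ContinuousLinearMap.proj j).comp (ContinuousLinearMap.snd ℝ _ _))
  have hG : HasStrictFDerivAt G G' (z, 0) := by
    refine (hasStrictFDerivAt_pi.mpr fun j => hd (f j)).prodMk (hasStrictFDerivAt_pi.mpr fun l => ?_)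
    refine ((ContinuousLinearMap.proj l).comp
      (ContinuousLinearMap.fst ℝ (Fin n → ℝ) (Fin p → ℝ))).hasStrictFDerivAt.add
      (HasStrictFDerivAt.fun_sum fun j _ => ?_)
    refine (((ContinuousLinearMap.proj j).comp (ContinuousLinearMap.snd ℝ (Fin n → ℝ)
      (Fin p → ℝ))).hasStrictFDerivAt.mul (hd (pderiv l (f j)))).congr_fderiv ?_
    simp
  have hinj : Function.Injective G' := by
    rw [injective_iff_map_eq_zero]
    rintro ⟨v, μ⟩ h0
    have h1 : ∀ j, ∑ l, eval z (pderiv l (f j)) * v l = 0 := fun j => by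
      simpa [G', d] using congrFun (congrArg Prod.fst h0) j
    have h2 : ∀ l, v l + ∑ j, eval z (pderiv l (f j)) * μ j = 0 := fun l => by
      simpa [G', d] using congrFun (congrArg Prod.snd h0) l
    have h3 : ∑ l, v l * v l = 0 := by
      calc ∑ l, v l * v l = ∑ l, -(∑ j, eval z (pderiv l (f j)) * μ j) * v l :=
            Finset.sum_congr rfl fun l _ => by rw [← eq_neg_of_add_eq_zero_left (h2 l)]
        _ = -∑ j, μ j * ∑ l, eval z (pderiv l (f j)) * v l := by
            simp only [neg_mul, Finset.sum_mul, Finset.mul_sum, Finset.sum_neg_distrib]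
            rw [Finset.sum_comm]
            simp only [mul_left_comm, mul_comm]
        _ = 0 := by simp [h1]
    have hv : v = 0 := by
      funext l
      exact mul_self_eq_zero.mp
        ((Finset.sum_eq_zero_iff_of_nonneg fun l _ => mul_self_nonneg (v l)).mp h3 l
          (Finset.mem_univ l))
    subst hv
    refine Prod.ext rfl ?_
    by_contra hμ
    have := (Matrix.rank_lt_card_iff_exists_vecMul_eq_zero
      (Matrix.of fun j l => eval z (pderiv l (f j)))).mpr ⟨μ, hμ, funext fun l => by
        simpa [Matrix.vecMul, dotProduct, mul_comm] using h2 l⟩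
    rw [hrank, Fintype.card_fin] at this
    exact this.false
  have hsurj : (G' : (Fin n → ℝ) × (Fin p → ℝ) →L[ℝ] (Fin p → ℝ) × (Fin n → ℝ)).range = ⊤ :=
    LinearMap.range_eq_top.mpr ((LinearMap.injective_iff_surjective_of_finrank_eq_finrank
      (f := (G' : (Fin n → ℝ) × (Fin p → ℝ) →ₗ[ℝ] (Fin p → ℝ) × (Fin n → ℝ)))
      (by simp [add_comm])).mp hinj)
  have hmap := hG.map_nhds_eq_of_surj hsurj
  obtain ⟨c, -, hc⟩ := Matrix.exists_injective_det_submatrix_ne_zero hrank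
  have hopen : ∀ᶠ y : (Fin n → ℝ) × (Fin p → ℝ) in 𝓝 (z, 0),
      ((Matrix.of fun j l => eval y.1 (pderiv l (f j))).submatrix id c).det ≠ 0 := by
    refine ContinuousAt.eventually_ne (Continuous.continuousAt ?_) hc
    refine Continuous.matrix_det (continuous_matrix fun j l => ?_)
    exact (continuous_eval _).comp continuous_fst
  have himage : ∀ᶠ w in 𝓝 (G (z, 0)), ∃ y,
      ((Matrix.of fun j l => eval y.1 (pderiv l (f j))).submatrix id c).det ≠ 0 ∧ G y = w := by
    rw [← hmap, Filter.eventually_map]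
    exact hopen.mono fun y hy => ⟨y, hy, rfl⟩
  have hGz : G (z, 0) = (0, z) := by
    ext <;> simp [G, hz]
  rw [hGz] at himage
  have hcont : Filter.Tendsto (fun b : Fin n → ℝ => ((0 : Fin p → ℝ), b)) (𝓝 z) (𝓝 (0, z)) :=
    (Continuous.prodMk_right _).tendsto z
  refine (hcont.eventually himage).mono ?_
  rintro b ⟨⟨x, μ⟩, hdet, hb⟩
  exact ⟨x, μ, fun j => congrFun (congrArg Prod.fst hb) j,
    Matrix.rank_eq_of_det_submatrix_ne_zero hdet,
    fun l => (congrFun (congrArg Prod.snd hb) l).symm⟩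

end RealPoints

section RealComplex

theorem Matrix.rank_map_ringHom_eq_iff {K L n : Type*} [Field K] [Field L] [Fintype n] {p : ℕ}
    (φ : K →+* L) (N : Matrix (Fin p) n K) : (N.map φ).rank = p ↔ N.rank = p := by
  have hdet : ∀ c : Fin p → n, ((N.map φ).submatrix id c).det = φ (N.submatrix id c).det :=
    fun c => by rw [RingHom.map_det]; rfl
  constructor <;> intro h <;> obtain ⟨c, -, hc⟩ := exists_injective_det_submatrix_ne_zero h
  · exact rank_eq_of_det_submatrix_ne_zero (c := c) fun h0 => hc (by rw [hdet, h0, map_zero])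
  · exact rank_eq_of_det_submatrix_ne_zero (c := c) (by rwa [hdet, map_ne_zero])

variable {n p M : ℕ} (F : Fin p → MvPolynomial (Fin n) ℚ)

/-- The Jacobian matrix of `F` as a matrix of complex polynomials. -/
noncomputable def polyJacobian : Matrix (Fin p) (Fin n) (MvPolynomial (Fin n) ℂ) :=
  Matrix.of fun j l => map (algebraMap ℚ ℂ) (pderiv l (F j))

theorem map_aeval_polyJacobian (x : Fin n → ℂ) : (polyJacobian F).map (aeval x) = jacC F x := by
  ext j l
  exact aeval_map_algebraMap ℂ x _

theorem setOf_aeval_map_eq_zero :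
    {x : Fin n → ℂ | ∀ j, aeval x (map (algebraMap ℚ ℂ) (F j)) = 0} = zeroSetC F := by
  simp only [aeval_map_algebraMap, zeroSetC]

theorem polarMatrix_polyJacobian {κ : Type} (x : Fin n → ℂ) (b : κ → Fin n → ℂ) :
    polarMatrix (polyJacobian F) x b =
      Matrix.fromRows (jacC F x) (Matrix.of fun k l => b k l - x l) := by
  rw [← map_aeval_polyJacobian]
  rfl

theorem Wdual_eq_zcl_polarLocus (A : Matrix (Fin (M + 1)) (Fin n) ℂ) :
    Wdual F A (p + M) = zcl (polarLocus (zeroSetC F) (polyJacobian F) fun q => A q.1 q.2) := by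
  simp only [Wdual, polarLocus, SregC, Set.mem_ofPred_eq, polarMatrix_polyJacobian,
    map_aeval_polyJacobian, and_assoc]

theorem subset_zcl {σ : Type} (T : Set (σ → ℂ)) : T ⊆ zcl T :=
  fun _ hx _ hg => hg _ hx

theorem vanishingIdeal_zcl {σ : Type} (T : Set (σ → ℂ)) :
    vanishingIdeal ℂ (zcl T) = vanishingIdeal ℂ T :=
  le_antisymm (vanishingIdeal_anti_mono (subset_zcl T)) fun _ hg _ hx => hx _ hg

theorem aeval_ofReal_comp {n : ℕ} (g : MvPolynomial (Fin n) ℚ) (x : Fin n → ℝ) :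
    aeval (fun j => (x j : ℂ)) g = (eval x (map (algebraMap ℚ ℝ) g) : ℝ) := by
  rw [eval_map, ← aeval_def, ← Complex.coe_algebraMap, ← aeval_algebraMap_apply]
  rfl

theorem jacC_ofReal_comp (x : Fin n → ℝ) : jacC F (fun j => (x j : ℂ)) =
    (Matrix.of fun j l => eval x (pderiv l (map (algebraMap ℚ ℝ) (F j)))).map Complex.ofRealHom := by
  ext j l
  simp [jacC, aeval_ofReal_comp, pderiv_map]

theorem eventually_polarLocus_nonempty {z : Fin n → ℝ} (hz : (fun j => (z j : ℂ)) ∈ SregC F) :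
    ∀ᶠ b in nhds z, ∀ a : Fin (M + 1) × Fin n → ℝ, (fun l => a (0, l)) = b →
      (polarLocus (zeroSetC F) (polyJacobian F) fun q => (a q : ℂ)).Nonempty := by
  have hz1 : ∀ j, eval z (map (algebraMap ℚ ℝ) (F j)) = 0 := fun j => by
    have := hz.1 j
    rw [aeval_ofReal_comp] at this
    exact_mod_cast this
  have hz2 := hz.2
  rw [jacC_ofReal_comp, Matrix.rank_map_ringHom_eq_iff] at hz2
  refine (exists_normal_through_nhds hz1 hz2).mono ?_
  rintro _ ⟨x, μ, hx, hrank, hb⟩ a rfl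
  refine ⟨fun j => (x j : ℂ), fun j => ?_, ?_, ChartEq.rank_polarMatrix_le (k₀ := 0)
    (a := fun q => (a q : ℂ)) (r := Sum.elim (fun j => (μ j : ℂ)) 0) (chartEq_iff.mpr fun l => ?_)⟩
  · rw [aeval_ofReal_comp, hx j, Complex.ofReal_zero]
  · rw [map_aeval_polyJacobian, jacC_ofReal_comp, Matrix.rank_map_ringHom_eq_iff]; exact hrank
  · have hJ : ∀ j, aeval (fun j => (x j : ℂ)) (polyJacobian F j l) =
        (eval x (pderiv l (map (algebraMap ℚ ℝ) (F j))) : ℝ) := fun j => by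
      rw [pderiv_map, ← aeval_ofReal_comp]
      exact aeval_map_algebraMap ℂ _ _
    simp [hb l, hJ]

end RealComplex

/-- Corollary 1 of the paper. Suppose the real variety `S_ℝ` contains a
regular point of `S` and let `1 ≤ i ≤ n - p`. Then there is a nonempty Euclidean-open set
`O` of real `(n-p-i+1) × n` matrices such that every `a ∈ O` has maximal rank
`n-p-i+1` and the dual polar variety `W_{K̄(ā)}(S)` is generic (of pure codimension `i`
in `S`, i.e. of pure dimension `n-p-i`) and nonempty. -/
theorem statement2 {n p i : ℕ} (hp1 : 1 ≤ p) (hpn : p ≤ n)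
    (hi1 : 1 ≤ i) (hi2 : i ≤ n - p)
    (F : Fin p → MvPolynomial (Fin n) ℚ)
    (hreg : IsRegSeq (List.ofFn F))
    (hrad : idealOfDef F)
    (hSne : (zeroSetC F).Nonempty)
    (hSdim : IsPureDim (zeroSetC F) (n - p))
    (hRreg : ∃ x : EuclideanSpace ℝ (Fin n), (fun j => (x j : ℂ)) ∈ SregC F) :
    ∃ O : Set (Matrix (Fin (n - p - i + 1)) (Fin n) ℝ),
      O.Nonempty ∧ IsOpen O ∧
      ∀ a ∈ O,
        a.rank = n - p - i + 1 ∧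
        IsPureDim (Wdual F (a.map (fun t : ℝ => (t : ℂ))) (n - i)) (n - p - i) ∧
        (Wdual F (a.map (fun t : ℝ => (t : ℂ))) (n - i)).Nonempty := by
  obtain ⟨z, hz⟩ := hRreg
  obtain ⟨d, hd⟩ : ∃ d, d + p = n := ⟨n - p, Nat.sub_add_cancel hpn⟩
  obtain ⟨M, hM⟩ : ∃ M, n - p - i = M := ⟨_, rfl⟩
  have hni : n - i = p + M := by omega
  rw [hM, hni]
  have hS : ringKrullDim (MvPolynomial (Fin n) ℂ ⧸ vanishingIdeal ℂ (zeroSetC F)) ≤ d := by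
    rw [show n - p = d by omega] at hSdim
    exact ringKrullDim_quotient_le_of_minimalPrimes fun P hP => (hSdim P hP).le
  have hgen := holdsGenerically_ringKrullDim_polarLocus (M := M) (J := polyJacobian F)
    (f := fun j => map (algebraMap ℚ ℂ) (F j)) (d := d)
    (by rwa [setOf_aeval_map_eq_zero]) hd (by omega)
  rw [setOf_aeval_map_eq_zero] at hgen
  obtain ⟨V, hVo, hVd, hV⟩ :=
    (hgen.and (holdsGenerically_rank_eq (show M + 1 ≤ n by omega))).exists_real
  obtain ⟨N, hN, hNo, hzN⟩ := eventually_nhds_iff.mp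
    (eventually_polarLocus_nonempty (M := M) F (z := z) hz)
  have hNo' : IsOpen {a : Fin (M + 1) × Fin n → ℝ | (fun l => a (0, l)) ∈ N} :=
    hNo.preimage (by fun_prop)
  obtain ⟨a₀, ha₀, ha₀V⟩ := hVd.inter_open_nonempty _ hNo' ⟨fun q => z q.2, hzN⟩
  have hcont : Continuous fun (a : Matrix (Fin (M + 1)) (Fin n) ℝ) (q : Fin (M + 1) × Fin n) =>
      a q.1 q.2 := continuous_pi fun q => continuous_id.matrix_elem q.1 q.2
  refine ⟨(fun a q => a q.1 q.2) ⁻¹' ({a | (fun l => a (0, l)) ∈ N} ∩ V),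
    ⟨Matrix.of fun k l => a₀ (k, l), ha₀, ha₀V⟩, (hNo'.inter hVo).preimage hcont, ?_⟩
  rintro a ⟨haN, haV⟩
  obtain ⟨hdim, hrank⟩ := hV _ haV
  rw [Wdual_eq_zcl_polarLocus]
  refine ⟨?_, ?_, (hN _ haN _ rfl).mono (subset_zcl _)⟩
  · exact (Matrix.rank_map_ringHom_eq_iff Complex.ofRealHom a).mp hrank
  · rw [IsPureDim, vanishingIdeal_zcl]
    exact hdim
end
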